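/- Fix an integer k ≥ 2. Let X_n = max_{v ∈ [n]} |Q(v)| be the maximum spectrum size in the random k-out digraph 𝒟_{n,k}. Then (X_n − ν_k n)/(σ_k √n) converges in distribution to a standard normal random variable as n → ∞; that is, for every x ∈ ℝ, P((X_n − ν_k n)/(σ_k √n) ≤ x) → (1/√(2π)) ∫_{−∞}^x e^{−t²/2} dt. -/

import Mathlib

open scoped Classical
open Filter MeasureTheory

/-- Probability of an event under the uniform random `k`-out digraph model `𝒟_{n,k}`:
a uniformly random function `f : [n] × [k] → [n]`. -/
noncomputable def prob (n k : ℕ) (P : (Fin n × Fin k → Fin n) → Prop) : ℝ :=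
  ((Finset.univ.filter P).card : ℝ) / (Fintype.card (Fin n × Fin k → Fin n) : ℝ)

/-- One arc step: there is a labeled arc from `u` to `v`. -/
def Step {n k : ℕ} (f : Fin n × Fin k → Fin n) (u v : Fin n) : Prop :=
  ∃ i : Fin k, f (u, i) = v

/-- `u` reaches `v` by following finitely many arcs. -/
def Reaches {n k : ℕ} (f : Fin n × Fin k → Fin n) : Fin n → Fin n → Prop :=
  Relation.ReflTransGen (Step f)

/-- A set of vertices is closed if no arc leaves it. -/
def IsClosedSet {n k : ℕ} (f : Fin n × Fin k → Fin n) (S : Set (Fin n)) : Prop :=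
  ∀ v ∈ S, ∀ i : Fin k, f (v, i) ∈ S

/-- A set of vertices is strongly connected if it is nonempty and
any two of its vertices reach each other. -/
def IsStrConn {n k : ℕ} (f : Fin n × Fin k → Fin n) (S : Set (Fin n)) : Prop :=
  S.Nonempty ∧ ∀ u ∈ S, ∀ v ∈ S, Reaches f u v

/-- `G` is the giant: a closed strongly connected set of maximum size,
ties broken by choosing the one containing the smallest vertex label. -/
def IsGiant {n k : ℕ} (f : Fin n × Fin k → Fin n) (G : Set (Fin n)) : Prop :=
  IsClosedSet f G ∧ IsStrConn f G ∧
    (∀ S : Set (Fin n), IsClosedSet f S → IsStrConn f S → S.ncard ≤ G.ncard) ∧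
    (∀ S : Set (Fin n), IsClosedSet f S → IsStrConn f S → S.ncard = G.ncard →
      ∃ v ∈ G, ∀ u ∈ S, v ≤ u)

/-- The spectrum of a vertex `v`: the set of vertices reachable from `v`, including `v`. -/
def specSet {n k : ℕ} (f : Fin n × Fin k → Fin n) (v : Fin n) : Set (Fin n) :=
  {u | Reaches f v u}

/-- The mean of a function on a finite type. -/
noncomputable def avg {α E : Type*} [Fintype α] [AddCommGroup E] [Module ℝ E] (F : α → E) : E :=
  (Fintype.card α : ℝ)⁻¹ • ∑ a, F a

section Avg

variable {α E : Type*} [Fintype α] [AddCommGroup E] [Module ℝ E]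

lemma avg_const [Nonempty α] (x : E) : avg (fun _ : α => x) = x := by
  have : (Fintype.card α : ℝ) ≠ 0 := by exact_mod_cast Fintype.card_ne_zero
  simp [avg, ← Nat.cast_smul_eq_nsmul ℝ, smul_smul, this]

lemma avg_add (F G : α → E) : avg (fun a => F a + G a) = avg F + avg G := by
  simp [avg, Finset.sum_add_distrib]

lemma avg_sub (F G : α → E) : avg (fun a => F a - G a) = avg F - avg G := by
  simp [avg, Finset.sum_sub_distrib, smul_sub]

lemma avg_sum {ι : Type*} (s : Finset ι) (F : ι → α → E) :
    avg (fun a => ∑ i ∈ s, F i a) = ∑ i ∈ s, avg (F i) := by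
  simp only [avg]
  rw [Finset.sum_comm, Finset.smul_sum]

lemma avg_mono {F G : α → ℝ} (h : ∀ a, F a ≤ G a) : avg F ≤ avg G := by
  simp only [avg, smul_eq_mul]
  gcongr
  exact h _

lemma avg_mul_left (c : ℝ) (F : α → ℝ) : avg (fun a => c * F a) = c * avg F := by
  simp only [avg, smul_eq_mul, ← Finset.mul_sum]; ring

lemma avg_complex_mul_left (c : ℂ) (F : α → ℂ) : avg (fun a => c * F a) = c * avg F := by
  simp only [avg, ← Finset.mul_sum, mul_smul_comm]

lemma avg_nonneg {F : α → ℝ} (h : ∀ a, 0 ≤ F a) : 0 ≤ avg F := by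
  simp only [avg, smul_eq_mul]
  exact mul_nonneg (by positivity) (Finset.sum_nonneg fun a _ => h a)

lemma norm_avg_le (F : α → ℂ) : ‖avg F‖ ≤ avg (fun a => ‖F a‖) := by
  simp only [avg, norm_smul, smul_eq_mul]
  rw [Real.norm_of_nonneg (by positivity)]
  gcongr
  exact norm_sum_le _ _

lemma re_avg (F : α → ℂ) : (avg F).re = avg (fun a => (F a).re) := by
  simp [avg]

/-- Resampling one coordinate does not change the mean. -/
lemma avg_update {ι β : Type*} [Fintype ι] [Fintype β] [DecidableEq ι] (x : ι)
    (G : (ι → β) → ℝ) :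
    avg G = avg fun w : β => avg fun h : ι → β => G (Function.update h x w) := by
  rcases isEmpty_or_nonempty β with hβ | hβ
  · have : IsEmpty (ι → β) := ⟨fun h => hβ.elim (h x)⟩
    simp [avg]
  have key : ∑ w : β, ∑ h : ι → β, G (Function.update h x w)
      = (Fintype.card β : ℝ) * ∑ h : ι → β, G h := by
    rw [← (Equiv.funSplitAt x β).symm.sum_comp, Fintype.sum_prod_type]
    simp_rw [← (Equiv.funSplitAt x β).symm.sum_comp
      (fun h => G (Function.update h x _)), Fintype.sum_prod_type]
    have h1 : ∀ (w b : β) (r : { j // j ≠ x } → β),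
        Function.update ((Equiv.funSplitAt x β).symm (b, r)) x w
          = (Equiv.funSplitAt x β).symm (w, r) := by
      intro w b r
      funext j
      by_cases hj : j = x
      · subst hj; simp
      · simp [hj]
    simp_rw [h1]
    simp [Finset.mul_sum]
  have hc : (Fintype.card β : ℝ) ≠ 0 := by exact_mod_cast Fintype.card_ne_zero
  simp only [avg, smul_eq_mul, ← Finset.mul_sum]
  rw [key]
  field_simp

end Avg

/-- The set of vertices reachable from a set of vertices. -/
noncomputable def reachFrom {n k : ℕ} (f : Fin n × Fin k → Fin n) (A : Finset (Fin n)) :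
    Finset (Fin n) :=
  Finset.univ.filter fun u => ∃ v ∈ A, Reaches f v u

section Reach

variable {n k : ℕ}

lemma subset_reachFrom (f : Fin n × Fin k → Fin n) (A : Finset (Fin n)) :
    A ⊆ reachFrom f A := by
  intro v hv
  simp only [reachFrom, Finset.mem_filter, Finset.mem_univ, true_and]
  exact ⟨v, hv, Relation.ReflTransGen.refl⟩

lemma map_mem_reachFrom {f : Fin n × Fin k → Fin n} {A : Finset (Fin n)} {v : Fin n}
    (hv : v ∈ reachFrom f A) (i : Fin k) : f (v, i) ∈ reachFrom f A := by
  simp only [reachFrom, Finset.mem_filter, Finset.mem_univ, true_and] at hv ⊢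
  obtain ⟨u, hu, huv⟩ := hv
  exact ⟨u, hu, huv.tail ⟨i, rfl⟩⟩

lemma reachFrom_subset_of_closed {f : Fin n × Fin k → Fin n} {A B : Finset (Fin n)}
    (hAB : A ⊆ B) (hB : ∀ v ∈ B, ∀ i, f (v, i) ∈ B) : reachFrom f A ⊆ B := by
  intro u hu
  simp only [reachFrom, Finset.mem_filter, Finset.mem_univ, true_and] at hu
  obtain ⟨v, hv, hvu⟩ := hu
  induction hvu with
  | refl => exact hAB hv
  | tail _ hst ih =>
    obtain ⟨i, rfl⟩ := hst
    exact hB _ ih i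

lemma reachFrom_mono (f : Fin n × Fin k → Fin n) {A B : Finset (Fin n)} (h : A ⊆ B) :
    reachFrom f A ⊆ reachFrom f B :=
  reachFrom_subset_of_closed (h.trans (subset_reachFrom f B))
    fun _ hv i => map_mem_reachFrom hv i

lemma reachFrom_union_eq {f : Fin n × Fin k → Fin n} {A B : Finset (Fin n)} :
    reachFrom f (reachFrom f A ∪ B) = reachFrom f (A ∪ B) := by
  apply Finset.Subset.antisymm
  · refine reachFrom_subset_of_closed (Finset.union_subset ?_ ?_)
      fun _ hv i => map_mem_reachFrom hv i
    · exact reachFrom_mono f Finset.subset_union_left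
    · exact Finset.subset_union_right.trans (subset_reachFrom f _)
  · exact reachFrom_mono f (Finset.union_subset_union_left (subset_reachFrom f A))

lemma specSet_eq (f : Fin n × Fin k → Fin n) (v : Fin n) :
    specSet f v = reachFrom f {v} := by
  ext u
  simp [specSet, reachFrom]

/-- The mean of `F` over all digraphs that agree with `g` on the arcs in `C`. -/
noncomputable def condAvg (C : Finset (Fin n × Fin k)) (g : Fin n × Fin k → Fin n)
    (F : (Fin n × Fin k → Fin n) → ℝ) : ℝ :=
  avg fun h => F (C.piecewise g h)

lemma condAvg_eq_avg_insert {C : Finset (Fin n × Fin k)} {x : Fin n × Fin k} (hx : x ∉ C)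
    (g : Fin n × Fin k → Fin n) (F : (Fin n × Fin k → Fin n) → ℝ) :
    condAvg C g F = avg fun w => condAvg (insert x C) (Function.update g x w) F := by
  unfold condAvg
  rw [avg_update x]
  congr 1
  funext w
  congr 1
  funext h
  congr 1
  funext y
  by_cases hy : y = x
  · subst hy
    simp [Finset.piecewise, hx]
  · simp [Finset.piecewise, hy]

lemma avg_ite_mem (hn : 0 < n) (A : Finset (Fin n)) (p q : ℝ) :
    avg (fun w => if w ∈ A then p else q)
      = (A.card / n : ℝ) * p + (1 - A.card / n : ℝ) * q := by
  have hn' : (n : ℝ) ≠ 0 := by positivity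
  have h : ((Finset.univ.filter fun w => w ∉ A).card : ℝ) = n - A.card := by
    have := Finset.card_filter_add_card_filter_not (s := (Finset.univ : Finset (Fin n)))
      (fun w => w ∈ A)
    simp only [Finset.filter_univ_mem, Finset.card_univ, Fintype.card_fin] at this
    rw [eq_sub_iff_add_eq']
    exact_mod_cast this
  simp only [avg, Finset.sum_ite, Finset.sum_const, nsmul_eq_mul, h, Fintype.card_fin,
    smul_eq_mul, Finset.filter_univ_mem]
  field_simp

/-- Exploring the digraph arc by arc from the start set `A₀`: a potential that is a
supermartingale along the exploration, and dominates the conditional mean of `F` when the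
exploration stops, dominates the conditional mean of `F` in every state. Here `A` is the set of
discovered vertices, `C` the set of revealed arcs, and `g` records their heads. -/
theorem condAvg_le_of_supermartingale (hn : 0 < n) (A₀ : Finset (Fin n)) (Ψ : ℕ → ℕ → ℝ)
    (F : (Fin n × Fin k → Fin n) → ℝ)
    (hstep : ∀ a c : ℕ, A₀.card ≤ a → a ≤ n → c < k * a →
      (a / n : ℝ) * Ψ a (c + 1) + (1 - a / n : ℝ) * Ψ (a + 1) (c + 1) ≤ Ψ a c)
    (hterm : ∀ (A : Finset (Fin n)) (g : Fin n × Fin k → Fin n), A₀ ⊆ A →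
      (∀ v ∈ A, ∀ i, g (v, i) ∈ A) →
      (∀ h, reachFrom ((A ×ˢ Finset.univ).piecewise g h) A₀ = A) →
      condAvg (A ×ˢ Finset.univ) g F ≤ Ψ A.card (k * A.card))
    (A : Finset (Fin n)) (C : Finset (Fin n × Fin k)) (g : Fin n × Fin k → Fin n)
    (hA : A₀ ⊆ A) (hC : C ⊆ A ×ˢ Finset.univ) (hg : ∀ x ∈ C, g x ∈ A)
    (hr : ∀ h, A ⊆ reachFrom (C.piecewise g h) A₀) :
    condAvg C g F ≤ Ψ A.card C.card := by
  induction hm : n * k - C.card using Nat.strong_induction_on generalizing A C g with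
  | _ m ih =>
  by_cases hCA : C = A ×ˢ Finset.univ
  · subst hCA
    have hcl : ∀ v ∈ A, ∀ i, g (v, i) ∈ A := fun v hv i => hg _ (by simp [hv])
    have := hterm A g hA hcl fun h => Finset.Subset.antisymm
      (reachFrom_subset_of_closed hA fun v hv i => by
        simpa [Finset.piecewise, hv] using hcl v hv i) (hr h)
    simpa [Finset.card_product, mul_comm] using this
  · obtain ⟨x, hxA, hxC⟩ := Finset.exists_of_ssubset (hC.ssubset_of_ne hCA)
    have hxA' : x.1 ∈ A := by simpa using hxA
    have hcard : C.card < k * A.card := by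
      have := Finset.card_lt_card (hC.ssubset_of_ne hCA)
      simpa [Finset.card_product, mul_comm] using this
    have hAn : A.card ≤ n := by simpa using Finset.card_le_univ A
    have hlt : C.card < n * k := hcard.trans_le (by rw [mul_comm]; gcongr)
    have hci : (insert x C).card = C.card + 1 := Finset.card_insert_of_notMem hxC
    rw [condAvg_eq_avg_insert hxC]
    have hpw : ∀ (w : Fin n) (h : Fin n × Fin k → Fin n),
        (insert x C).piecewise (Function.update g x w) h
          = C.piecewise g (Function.update h x w) := by
      intro w h
      funext y
      by_cases hy : y = x
      · subst hy
        simp [Finset.piecewise, hxC]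
      · simp [Finset.piecewise, hy]
    refine (avg_mono (G := fun w => if w ∈ A then Ψ A.card (C.card + 1)
      else Ψ (A.card + 1) (C.card + 1)) fun w => ?_).trans ?_
    · split_ifs with hw
      · rw [← hci]
        refine ih (n * k - (insert x C).card) (by omega) A (insert x C) _ hA
          (Finset.insert_subset hxA hC) ?_ ?_ rfl
        · intro y hy
          by_cases hyx : y = x
          · subst hyx; simpa using hw
          · simpa [hyx] using hg y (Finset.mem_of_mem_insert_of_ne hy hyx)
        · intro h
          rw [hpw]
          exact hr _
      · rw [← hci, ← Finset.card_insert_of_notMem hw]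
        refine ih (n * k - (insert x C).card) (by omega) (insert w A) (insert x C) _
          (hA.trans (Finset.subset_insert _ _)) ?_ ?_ ?_ rfl
        · exact (Finset.insert_subset hxA hC).trans
            (Finset.product_subset_product_left (Finset.subset_insert _ _))
        · intro y hy
          by_cases hyx : y = x
          · subst hyx; simp
          · simpa [hyx] using Or.inr (hg y (Finset.mem_of_mem_insert_of_ne hy hyx))
        · intro h
          rw [hpw]
          refine Finset.insert_subset ?_ (hr _)
          have := map_mem_reachFrom (hr (Function.update h x w) hxA') x.2
          simpa [Finset.piecewise, hxC] using this
    · rw [avg_ite_mem hn]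
      exact hstep _ _ (Finset.card_le_card hA) hAn hcard

lemma condAvg_empty (g : Fin n × Fin k → Fin n) (F : (Fin n × Fin k → Fin n) → ℝ) :
    condAvg ∅ g F = avg F := by
  simp [condAvg]

lemma condAvg_const (hn : 0 < n) (C : Finset (Fin n × Fin k)) (g : Fin n × Fin k → Fin n)
    {F : (Fin n × Fin k → Fin n) → ℝ} {y : ℝ} (h : ∀ h, F (C.piecewise g h) = y) :
    condAvg C g F = y := by
  have : Nonempty (Fin n) := ⟨⟨0, hn⟩⟩
  simp only [condAvg, h]
  exact avg_const y

lemma condAvg_mono {C : Finset (Fin n × Fin k)} {g : Fin n × Fin k → Fin n}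
    {F G : (Fin n × Fin k → Fin n) → ℝ}
    (h : ∀ h, F (C.piecewise g h) ≤ G (C.piecewise g h)) :
    condAvg C g F ≤ condAvg C g G :=
  avg_mono h

/-- The unconditional form of `condAvg_le_of_supermartingale` for a single start vertex. -/
theorem avg_le_of_supermartingale (hn : 0 < n) (v₀ : Fin n) (Ψ : ℕ → ℕ → ℝ)
    (F : (Fin n × Fin k → Fin n) → ℝ)
    (hstep : ∀ a c : ℕ, 1 ≤ a → a ≤ n → c < k * a →
      (a / n : ℝ) * Ψ a (c + 1) + (1 - a / n : ℝ) * Ψ (a + 1) (c + 1) ≤ Ψ a c)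
    (hterm : ∀ (A : Finset (Fin n)) (g : Fin n × Fin k → Fin n), {v₀} ⊆ A →
      (∀ v ∈ A, ∀ i, g (v, i) ∈ A) →
      (∀ h, reachFrom ((A ×ˢ Finset.univ).piecewise g h) {v₀} = A) →
      condAvg (A ×ˢ Finset.univ) g F ≤ Ψ A.card (k * A.card)) :
    avg F ≤ Ψ 1 0 := by
  have := condAvg_le_of_supermartingale hn {v₀} Ψ F (by simpa using hstep) hterm {v₀} ∅
    (fun _ => v₀) (by simp) (by simp) (by simp) (fun h => subset_reachFrom _ _)
  simpa [condAvg_empty] using this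

/-- Bounds for functions of the number of vertices reachable from a vertex. -/
theorem avg_card_reachFrom_le (hn : 0 < n) (v₀ : Fin n) (Ψ : ℕ → ℕ → ℝ) (F : ℕ → ℝ)
    (hstep : ∀ a c : ℕ, 1 ≤ a → a ≤ n → c < k * a →
      (a / n : ℝ) * Ψ a (c + 1) + (1 - a / n : ℝ) * Ψ (a + 1) (c + 1) ≤ Ψ a c)
    (hterm : ∀ a, 1 ≤ a → a ≤ n → F a ≤ Ψ a (k * a)) :
    avg (fun f : Fin n × Fin k → Fin n => F (reachFrom f {v₀}).card) ≤ Ψ 1 0 := by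
  refine avg_le_of_supermartingale hn v₀ Ψ _ hstep fun A g hA _ hr => ?_
  rw [condAvg_const hn _ _ (y := F A.card) fun h => by rw [hr]]
  exact hterm _ (by simpa using Finset.card_le_card hA) (by simpa using Finset.card_le_univ A)

/-- Approximation of the mean of a complex function of the number of reachable vertices by an
approximate martingale. -/
theorem norm_avg_card_reachFrom_sub_le (hn : 0 < n) (v₀ : Fin n) (Φ : ℕ → ℕ → ℂ)
    (e : ℕ → ℕ → ℝ)
    (hstep : ∀ a c : ℕ, 1 ≤ a → a ≤ n → c < k * a →
      ‖(a / n : ℝ) * Φ a (c + 1) + (1 - a / n : ℝ) * Φ (a + 1) (c + 1) - Φ a c‖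
        + ((a / n : ℝ) * e a (c + 1) + (1 - a / n : ℝ) * e (a + 1) (c + 1)) ≤ e a c)
    (hterm : ∀ a, 1 ≤ a → a ≤ n → 0 ≤ e a (k * a)) :
    ‖avg (fun f : Fin n × Fin k → Fin n =>
      Φ (reachFrom f {v₀}).card (k * (reachFrom f {v₀}).card)) - Φ 1 0‖ ≤ e 1 0 := by
  set S := avg (fun f : Fin n × Fin k → Fin n =>
      Φ (reachFrom f {v₀}).card (k * (reachFrom f {v₀}).card)) with hS
  obtain ⟨ζ, hζ, hζS⟩ : ∃ ζ : ℂ, ‖ζ‖ = 1 ∧ ζ * (S - Φ 1 0) = (‖S - Φ 1 0‖ : ℝ) := by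
    by_cases h0 : S - Φ 1 0 = 0
    · exact ⟨1, by simp, by simp [h0]⟩
    · refine ⟨(starRingEnd ℂ) (S - Φ 1 0) / ‖S - Φ 1 0‖, ?_, ?_⟩
      · rw [norm_div, RCLike.norm_conj, Complex.norm_real, norm_norm,
          div_self (norm_ne_zero_iff.2 h0)]
      · have : ((‖S - Φ 1 0‖ : ℝ) : ℂ) ≠ 0 := by simpa using h0
        rw [div_mul_eq_mul_div, div_eq_iff this, mul_comm, Complex.mul_conj,
          Complex.normSq_eq_norm_sq]
        push_cast
        ring
  have main := avg_card_reachFrom_le (k := k) hn v₀ (fun a c => (ζ * Φ a c).re + e a c)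
    (fun a => (ζ * Φ a (k * a)).re) (by
      intro a c ha han hc
      have h1 := hstep a c ha han hc
      have h2 : (ζ * ((a / n : ℝ) * Φ a (c + 1) + (1 - a / n : ℝ) * Φ (a + 1) (c + 1)
          - Φ a c)).re ≤ ‖(a / n : ℝ) * Φ a (c + 1) + (1 - a / n : ℝ) * Φ (a + 1) (c + 1)
          - Φ a c‖ := by
        refine (Complex.re_le_norm _).trans ?_
        rw [norm_mul, hζ, one_mul]
      have h3 : (ζ * ((a / n : ℝ) * Φ a (c + 1) + (1 - a / n : ℝ) * Φ (a + 1) (c + 1)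
          - Φ a c)).re = (a / n : ℝ) * (ζ * Φ a (c + 1)).re
          + (1 - a / n : ℝ) * (ζ * Φ (a + 1) (c + 1)).re - (ζ * Φ a c).re := by
        rw [← Complex.re_ofReal_mul, ← Complex.re_ofReal_mul, ← Complex.add_re,
          ← Complex.sub_re]
        congr 1
        ring
      linarith)
    (fun a ha han => by linarith [hterm a ha han])
  have h4 : avg (fun f : Fin n × Fin k → Fin n => (ζ * Φ (reachFrom f {v₀}).card
      (k * (reachFrom f {v₀}).card)).re) = (ζ * S).re := by
    rw [hS, ← avg_complex_mul_left, re_avg]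
  have h5 := congrArg Complex.re hζS
  rw [Complex.ofReal_re, mul_sub, Complex.sub_re] at h5
  rw [h4] at main
  linarith

lemma prob_eq_avg (P : (Fin n × Fin k → Fin n) → Prop) :
    prob n k P = avg fun f => if P f then (1 : ℝ) else 0 := by
  simp [prob, avg, div_eq_inv_mul]

end Reach

/-- The rescaled deviation of the exploration from its fluid limit, when `a` vertices have been
discovered and `c` arcs revealed. -/
noncomputable def dev (n a c : ℕ) : ℝ :=
  √n * ((1 - a / n) * Real.exp (c / n) - 1)

/-- The limiting variance of `dev` at time `s`. -/
noncomputable def devVar (s : ℝ) : ℝ := Real.exp s - 1 - s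

section Estimates

lemma exp_sub_one_sub_mem {ε : ℝ} (h0 : 0 ≤ ε) (h1 : ε ≤ 1) :
    0 ≤ Real.exp ε - 1 - ε ∧ Real.exp ε - 1 - ε ≤ ε ^ 2 := by
  refine ⟨by linarith [Real.add_one_le_exp ε], ?_⟩
  have := Real.abs_exp_sub_one_sub_id_le (x := ε) (by rwa [abs_of_nonneg h0])
  exact (le_abs_self _).trans this

lemma increment_bounds {β ε : ℝ} (hβ0 : 0 ≤ β) (hβ1 : β ≤ 1) (h0 : 0 ≤ ε) (h1 : ε ≤ 1) :
    |β * ((β - ε) * Real.exp ε - β) + (1 - β) * (β * (Real.exp ε - 1))| ≤ ε ^ 2 ∧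
    |(β - ε) * Real.exp ε - β| ≤ 3 * ε ∧ |β * (Real.exp ε - 1)| ≤ 3 * ε ∧
    |β * ((β - ε) * Real.exp ε - β) ^ 2 + (1 - β) * (β * (Real.exp ε - 1)) ^ 2
      - ε ^ 2 * (β * (1 - β))| ≤ 30 * ε ^ 3 := by
  obtain ⟨hρ0, hρ1⟩ := exp_sub_one_sub_mem h0 h1
  obtain ⟨ρ, hρ⟩ : ∃ ρ, Real.exp ε = 1 + ε + ρ := ⟨Real.exp ε - 1 - ε, by ring⟩
  rw [hρ] at hρ0 hρ1 ⊢
  have hρ0 : 0 ≤ ρ := by linarith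
  have hρ1 : ρ ≤ ε ^ 2 := by linarith
  have hε2 : ε ^ 2 ≤ ε := by nlinarith
  have hρε : ρ ≤ ε := by linarith
  have hβε : 0 ≤ β * ε := by positivity
  have hβε1 : β * ε ≤ ε := by nlinarith
  have hβρ : 0 ≤ β * ρ := by positivity
  have hβρ1 : β * ρ ≤ ρ := by nlinarith
  have hερ : 0 ≤ ε * ρ := by positivity
  have hερ1 : ε * ρ ≤ ρ := by nlinarith
  refine ⟨?_, ?_, ?_, ?_⟩
  · have : β * ((β - ε) * (1 + ε + ρ) - β) + (1 - β) * (β * (1 + ε + ρ - 1))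
        = β * (ρ * (1 - ε) - ε ^ 2) := by ring
    rw [this, abs_mul, abs_of_nonneg hβ0]
    have h2 : |ρ * (1 - ε) - ε ^ 2| ≤ ε ^ 2 := by
      rw [abs_le]
      constructor <;> nlinarith
    calc β * |ρ * (1 - ε) - ε ^ 2| ≤ 1 * ε ^ 2 := by gcongr
      _ = ε ^ 2 := one_mul _
  · rw [abs_le]
    constructor <;> nlinarith
  · rw [abs_le]
    constructor <;> nlinarith
  · have : β * ((β - ε) * (1 + ε + ρ) - β) ^ 2 + (1 - β) * (β * (1 + ε + ρ - 1)) ^ 2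
        - ε ^ 2 * (β * (1 - β))
        = β * (β * (ρ * (2 * ε + ρ)) - 2 * β * (ε * (ε + ρ) ^ 2 + ε * ρ)
          + ε ^ 2 * ((ε + ρ) * (2 + ε + ρ))) := by ring
    rw [this, abs_mul, abs_of_nonneg hβ0]
    have e1 : ρ * (2 * ε + ρ) ≤ 3 * ε ^ 3 := by
      calc ρ * (2 * ε + ρ) ≤ ε ^ 2 * (2 * ε + ε) := by gcongr
        _ = 3 * ε ^ 3 := by ring
    have e2 : ε * (ε + ρ) ^ 2 + ε * ρ ≤ 5 * ε ^ 3 := by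
      calc ε * (ε + ρ) ^ 2 + ε * ρ ≤ ε * (ε + ε) ^ 2 + ε * ε ^ 2 := by gcongr
        _ = 5 * ε ^ 3 := by ring
    have e3 : ε ^ 2 * ((ε + ρ) * (2 + ε + ρ)) ≤ 8 * ε ^ 3 := by
      calc ε ^ 2 * ((ε + ρ) * (2 + ε + ρ)) ≤ ε ^ 2 * ((ε + ε) * (2 + 1 + 1)) := by
            gcongr
            linarith
        _ = 8 * ε ^ 3 := by ring
    have e1' : 0 ≤ ρ * (2 * ε + ρ) := by positivity
    have e2' : 0 ≤ ε * (ε + ρ) ^ 2 + ε * ρ := by positivity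
    have e3' : 0 ≤ ε ^ 2 * ((ε + ρ) * (2 + ε + ρ)) := by positivity
    have h2 : |β * (ρ * (2 * ε + ρ)) - 2 * β * (ε * (ε + ρ) ^ 2 + ε * ρ)
          + ε ^ 2 * ((ε + ρ) * (2 + ε + ρ))| ≤ 30 * ε ^ 3 := by
      generalize ρ * (2 * ε + ρ) = x at *
      generalize ε * (ε + ρ) ^ 2 + ε * ρ = y at *
      generalize ε ^ 2 * ((ε + ρ) * (2 + ε + ρ)) = z at *
      rw [abs_le]
      have : 0 ≤ β * x := by positivity
      have : β * x ≤ x := by nlinarith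
      have : 0 ≤ β * y := by positivity
      have : β * y ≤ y := by nlinarith
      constructor <;> nlinarith
    calc _ ≤ 1 * (30 * ε ^ 3) := by gcongr
      _ = 30 * ε ^ 3 := one_mul _

set_option maxHeartbeats 1000000 in
/-- First and second moments of the increments of `dev` along the exploration. -/
lemma dev_step_moments {n k a c : ℕ} (hn : 0 < n) (han : a ≤ n) (hc : c ≤ k * n) :
    |(1 - a / n : ℝ) * (dev n (a + 1) (c + 1) - dev n a c)
      + (a / n : ℝ) * (dev n a (c + 1) - dev n a c)| ≤ Real.exp k / (n * √n) ∧
    |dev n (a + 1) (c + 1) - dev n a c| ≤ 3 * Real.exp k / √n ∧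
    |dev n a (c + 1) - dev n a c| ≤ 3 * Real.exp k / √n ∧
    0 ≤ devVar ((c + 1 : ℕ) / n) - devVar (c / n) ∧
    devVar ((c + 1 : ℕ) / n) - devVar (c / n) ≤ 3 * Real.exp k / n ∧
    |devVar ((c + 1 : ℕ) / n) - devVar (c / n)
      - ((1 - a / n : ℝ) * (dev n (a + 1) (c + 1) - dev n a c) ^ 2
      + (a / n : ℝ) * (dev n a (c + 1) - dev n a c) ^ 2)|
      ≤ 32 * Real.exp k ^ 2 * (1 + |dev n a c|) / (n * √n) ∧
    |dev n a c| ≤ Real.exp k * √n := by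
  have hn0 : (0 : ℝ) < n := by exact_mod_cast hn
  have hn1 : (1 : ℝ) ≤ n := by exact_mod_cast hn
  have ha0 : (0 : ℝ) ≤ a / n := by positivity
  have ha1 : (a / n : ℝ) ≤ 1 := by rw [div_le_one hn0]; exact_mod_cast han
  set β : ℝ := 1 - a / n with hβ
  have hβ0 : 0 ≤ β := by linarith
  have hβ1 : β ≤ 1 := by linarith
  have han' : (a / n : ℝ) = 1 - β := by rw [hβ]; ring
  set ε : ℝ := 1 / n with hε
  have hε0 : 0 ≤ ε := by positivity
  have hε1 : ε ≤ 1 := by rw [hε, div_le_one hn0]; exact hn1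
  set s : ℝ := c / n with hs
  have hs0 : 0 ≤ s := by positivity
  have hsk : s ≤ k := by rw [hs, div_le_iff₀ hn0]; exact_mod_cast hc
  have hs1 : ((c + 1 : ℕ) / n : ℝ) = s + ε := by rw [hs, hε]; push_cast; ring
  have hb1 : (1 - (a + 1 : ℕ) / n : ℝ) = β - ε := by rw [hβ, hε]; push_cast; ring
  set q := Real.exp s with hq
  set B := Real.exp k with hB
  have hqB : q ≤ B := Real.exp_le_exp.2 hsk
  have hq1 : 1 ≤ q := Real.one_le_exp hs0
  have hB1 : 1 ≤ B := hq1.trans hqB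
  have hBB : B ≤ B ^ 2 := by rw [pow_two]; exact le_mul_of_one_le_left (by linarith) hB1
  have hq0 : 0 < q := Real.exp_pos _
  have hsq : √(n : ℝ) * √n = n := Real.mul_self_sqrt hn0.le
  have hsq0 : 0 < √(n : ℝ) := Real.sqrt_pos.2 hn0
  have hsq1 : 1 ≤ √(n : ℝ) := by rw [Real.one_le_sqrt]; exact hn1
  have hsqn : √(n : ℝ) ≤ n := by
    conv_rhs => rw [← hsq]
    exact le_mul_of_one_le_left hsq0.le hsq1
  obtain ⟨m1, m2, m3, m4⟩ := increment_bounds hβ0 hβ1 hε0 hε1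
  obtain ⟨hρ0, hρ1⟩ := exp_sub_one_sub_mem hε0 hε1
  set d1 := (β - ε) * Real.exp ε - β with hd1
  set d0 := β * (Real.exp ε - 1) with hd0
  have D1 : dev n (a + 1) (c + 1) - dev n a c = √n * q * d1 := by
    simp only [dev]
    rw [hs1, hb1, Real.exp_add, hd1]
    ring
  have D0 : dev n a (c + 1) - dev n a c = √n * q * d0 := by
    simp only [dev]
    rw [hs1, Real.exp_add, hd0]
    ring
  have hdev : dev n a c = √n * (β * q - 1) := rfl
  have V1 : devVar ((c + 1 : ℕ) / n) - devVar s = q * (Real.exp ε - 1 - ε) + (q - 1) * ε := by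
    rw [hs1]
    simp only [devVar, Real.exp_add]
    rw [← hq]
    ring
  have hεn : √(n : ℝ) * ε = 1 / √n := by
    rw [hε, eq_div_iff hsq0.ne', mul_right_comm, hsq]; field_simp
  rw [D1, D0, V1, han']
  refine ⟨?_, ?_, ?_, ?_, ?_, ?_, ?_⟩
  · have : β * (√n * q * d1) + (1 - β) * (√n * q * d0) = √n * q * (β * d1 + (1 - β) * d0) := by
      ring
    rw [this, abs_mul, abs_of_nonneg (by positivity)]
    calc √n * q * |β * d1 + (1 - β) * d0| ≤ √n * B * ε ^ 2 := by gcongr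
      _ = B * ε * (√n * ε) := by ring
      _ = B / (n * √n) := by rw [hεn, hε]; field_simp
  · rw [abs_mul, abs_of_nonneg (by positivity)]
    calc √n * q * |d1| ≤ √n * B * (3 * ε) := by gcongr
      _ = 3 * B * (√n * ε) := by ring
      _ = 3 * B / √n := by rw [hεn]; ring
  · rw [abs_mul, abs_of_nonneg (by positivity)]
    calc √n * q * |d0| ≤ √n * B * (3 * ε) := by gcongr
      _ = 3 * B * (√n * ε) := by ring
      _ = 3 * B / √n := by rw [hεn]; ring
  · have : 0 ≤ (q - 1) * ε := mul_nonneg (by linarith) hε0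
    have : 0 ≤ q * (Real.exp ε - 1 - ε) := by positivity
    linarith
  · have e1 : q * (Real.exp ε - 1 - ε) ≤ B * ε := by
      gcongr
      nlinarith
    have e2 : (q - 1) * ε ≤ B * ε := by
      gcongr
      linarith
    have e3 : 3 * B / n = 3 * (B * ε) := by rw [hε]; ring
    have : 0 ≤ B * ε := by positivity
    linarith
  · have key : q * (Real.exp ε - 1 - ε) + (q - 1) * ε
        - (β * (√n * q * d1) ^ 2 + (1 - β) * (√n * q * d0) ^ 2)
        = q * (Real.exp ε - 1 - ε) + ε * ((β * q - 1) * (β * q + 1 - q))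
          - n * q ^ 2 * (β * d1 ^ 2 + (1 - β) * d0 ^ 2 - ε ^ 2 * (β * (1 - β))) := by
      have h1 : (√n * q * d1) ^ 2 = n * q ^ 2 * d1 ^ 2 := by
        rw [mul_pow, mul_pow, pow_two, hsq]
      have h0 : (√n * q * d0) ^ 2 = n * q ^ 2 * d0 ^ 2 := by
        rw [mul_pow, mul_pow, pow_two, hsq]
      have h2 : n * ε ^ 2 = ε := by rw [hε]; field_simp
      rw [h1, h0]
      linear_combination (- q ^ 2 * β * (1 - β)) * h2
    rw [key]
    have hnn : ε ^ 2 ≤ 1 / (n * √n) := by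
      rw [hε, div_pow, one_pow]
      apply one_div_le_one_div_of_le (by positivity)
      rw [pow_two]
      gcongr
    have b1 : |q * (Real.exp ε - 1 - ε)| ≤ B ^ 2 * ε ^ 2 := by
      rw [abs_of_nonneg (by positivity)]
      calc q * (Real.exp ε - 1 - ε) ≤ B * ε ^ 2 := by gcongr
        _ ≤ B ^ 2 * ε ^ 2 := by gcongr
    have b2 : |ε * ((β * q - 1) * (β * q + 1 - q))| ≤ B ^ 2 * |dev n a c| * (1 / (n * √n)) := by
      have h1 : |β * q - 1| = |dev n a c| / √n := by
        rw [hdev, abs_mul, abs_of_pos hsq0]; field_simp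
      have h2 : |β * q + 1 - q| ≤ B ^ 2 := by
        have : β * q ≤ q := mul_le_of_le_one_left hq0.le hβ1
        have : 0 ≤ β * q := by positivity
        rw [abs_le]
        constructor <;> linarith
      rw [abs_mul, abs_mul, h1, abs_of_nonneg hε0, hε]
      calc 1 / n * (|dev n a c| / √n * |β * q + 1 - q|)
          ≤ 1 / n * (|dev n a c| / √n * B ^ 2) := by gcongr
        _ = _ := by field_simp
    have b3 : |n * q ^ 2 * (β * d1 ^ 2 + (1 - β) * d0 ^ 2 - ε ^ 2 * (β * (1 - β)))|
        ≤ 30 * B ^ 2 * ε ^ 2 := by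
      rw [abs_mul, abs_of_nonneg (by positivity)]
      calc _ ≤ n * B ^ 2 * (30 * ε ^ 3) := by gcongr
        _ = 30 * B ^ 2 * ε ^ 2 := by rw [hε]; field_simp
    calc _ ≤ |q * (Real.exp ε - 1 - ε)| + |ε * ((β * q - 1) * (β * q + 1 - q))|
          + |n * q ^ 2 * (β * d1 ^ 2 + (1 - β) * d0 ^ 2 - ε ^ 2 * (β * (1 - β)))| :=
          (abs_sub _ _).trans (by gcongr; exact abs_add_le _ _)
      _ ≤ B ^ 2 * ε ^ 2 + B ^ 2 * |dev n a c| * (1 / (n * √n)) + 30 * B ^ 2 * ε ^ 2 := by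
          gcongr
      _ ≤ B ^ 2 * (1 / (n * √n)) + B ^ 2 * |dev n a c| * (1 / (n * √n))
          + 30 * B ^ 2 * (1 / (n * √n)) := by gcongr
      _ ≤ 32 * B ^ 2 * (1 + |dev n a c|) * (1 / (n * √n)) := by
          have : 0 ≤ B ^ 2 * (1 / (n * √n)) := by positivity
          have : 0 ≤ B ^ 2 * |dev n a c| * (1 / (n * √n)) := by positivity
          linarith
      _ = _ := by ring
  · rw [hdev, abs_mul, abs_of_pos hsq0, mul_comm B]
    gcongr
    have : β * q ≤ q := mul_le_of_le_one_left hq0.le hβ1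
    have : 0 ≤ β * q := by positivity
    rw [abs_le]
    constructor <;> linarith

lemma norm_exp_sub_quadratic_le (w : ℂ) :
    ‖Complex.exp w - (1 + w + w ^ 2 / 2)‖ ≤ ‖w‖ ^ 3 * Real.exp ‖w‖ := by
  have := Complex.norm_exp_sub_sum_le_norm_mul_exp w 3
  simpa [Finset.sum_range_succ] using this

/-- One step of the characteristic function estimate: a small two-point random variable with
nearly vanishing mean and variance close to `v`. -/
lemma norm_two_point_charFun_sub_one_le {θ C p x₁ x₀ v δ m : ℝ} (hC : 0 ≤ C) (hp0 : 0 ≤ p)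
    (hp1 : p ≤ 1) (hδ0 : 0 ≤ δ) (hδ1 : δ ≤ 1) (hm : 0 ≤ m)
    (hmean : |p * x₁ + (1 - p) * x₀| ≤ C * δ ^ 3) (h₁ : |x₁| ≤ C * δ) (h₀ : |x₀| ≤ C * δ)
    (hv0 : 0 ≤ v) (hv1 : v ≤ C * δ ^ 2)
    (hvar : |v - (p * x₁ ^ 2 + (1 - p) * x₀ ^ 2)| ≤ C * δ ^ 3 * (1 + m)) :
    ‖(p : ℂ) * Complex.exp (θ * x₁ * Complex.I + θ ^ 2 * v / 2)
      + (1 - p : ℝ) * Complex.exp (θ * x₀ * Complex.I + θ ^ 2 * v / 2) - 1‖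
      ≤ ((C * (|θ| + θ ^ 2)) ^ 3 * Real.exp (C * (|θ| + θ ^ 2)) + |θ| * C * (1 + θ ^ 2 * C)
        + θ ^ 2 * C + θ ^ 4 * C ^ 2) * δ ^ 3 * (1 + m) := by
  set D := C * (|θ| + θ ^ 2) with hD
  have hD0 : 0 ≤ D := by positivity
  have hw : ∀ x : ℝ, |x| ≤ C * δ →
      ‖(θ * x * Complex.I + θ ^ 2 * v / 2 : ℂ)‖ ≤ D * δ := by
    intro x hx
    calc ‖(θ * x * Complex.I + θ ^ 2 * v / 2 : ℂ)‖
        ≤ ‖(θ * x * Complex.I : ℂ)‖ + ‖(θ ^ 2 * v / 2 : ℂ)‖ := norm_add_le _ _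
      _ = |θ| * |x| + θ ^ 2 * v / 2 := by
          simp [abs_of_nonneg hv0]
      _ ≤ |θ| * (C * δ) + θ ^ 2 * (C * δ ^ 2) / 2 := by gcongr
      _ ≤ |θ| * (C * δ) + θ ^ 2 * (C * δ) := by
          have h1 : δ ^ 2 ≤ δ := by nlinarith
          have h2 : 0 ≤ θ ^ 2 * (C * δ ^ 2) := by positivity
          have h3 : θ ^ 2 * (C * δ ^ 2) ≤ θ ^ 2 * (C * δ) := by gcongr
          linarith
      _ = D * δ := by rw [hD]; ring
  have hexp : ∀ x : ℝ, |x| ≤ C * δ →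
      ‖Complex.exp (θ * x * Complex.I + θ ^ 2 * v / 2)
        - (1 + (θ * x * Complex.I + θ ^ 2 * v / 2) + (θ * x * Complex.I + θ ^ 2 * v / 2) ^ 2 / 2)‖
        ≤ D ^ 3 * Real.exp D * δ ^ 3 := by
    intro x hx
    refine (norm_exp_sub_quadratic_le _).trans ?_
    calc _ ≤ (D * δ) ^ 3 * Real.exp (D * δ) := by gcongr <;> exact hw x hx
      _ ≤ (D * δ) ^ 3 * Real.exp D := by
          gcongr
          nlinarith
      _ = _ := by ring
  set w₁ : ℂ := θ * x₁ * Complex.I + θ ^ 2 * v / 2 with hw₁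
  set w₀ : ℂ := θ * x₀ * Complex.I + θ ^ 2 * v / 2 with hw₀
  have hdec : (p : ℂ) * Complex.exp w₁ + (1 - p : ℝ) * Complex.exp w₀ - 1
      = (p : ℂ) * (Complex.exp w₁ - (1 + w₁ + w₁ ^ 2 / 2))
        + (1 - p : ℝ) * (Complex.exp w₀ - (1 + w₀ + w₀ ^ 2 / 2))
        + ((θ * (1 + θ ^ 2 * v / 2) * (p * x₁ + (1 - p) * x₀) : ℝ) * Complex.I
        + ((θ ^ 2 / 2 * (v - (p * x₁ ^ 2 + (1 - p) * x₀ ^ 2)) : ℝ)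
        + (θ ^ 4 * v ^ 2 / 8 : ℝ))) := by
    rw [hw₁, hw₀]
    push_cast
    ring_nf
    simp only [Complex.I_sq]
    ring
  rw [hdec]
  have t1 : ‖(p : ℂ) * (Complex.exp w₁ - (1 + w₁ + w₁ ^ 2 / 2))‖
      ≤ p * (D ^ 3 * Real.exp D * δ ^ 3) := by
    rw [norm_mul, Complex.norm_real, Real.norm_of_nonneg hp0]
    gcongr
    exact hexp x₁ h₁
  have t2 : ‖((1 - p : ℝ) : ℂ) * (Complex.exp w₀ - (1 + w₀ + w₀ ^ 2 / 2))‖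
      ≤ (1 - p) * (D ^ 3 * Real.exp D * δ ^ 3) := by
    rw [norm_mul, Complex.norm_real, Real.norm_of_nonneg (by linarith)]
    have : 0 ≤ 1 - p := by linarith
    gcongr
    exact hexp x₀ h₀
  have hδ2 : δ ^ 2 ≤ 1 := pow_le_one₀ hδ0 hδ1
  have hvC : v ≤ C := hv1.trans (by nlinarith)
  have t3 : ‖((θ * (1 + θ ^ 2 * v / 2) * (p * x₁ + (1 - p) * x₀) : ℝ) : ℂ) * Complex.I‖
      ≤ |θ| * C * (1 + θ ^ 2 * C) * δ ^ 3 := by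
    rw [norm_mul, Complex.norm_I, mul_one, Complex.norm_real, Real.norm_eq_abs, abs_mul, abs_mul,
      abs_of_nonneg (a := 1 + θ ^ 2 * v / 2) (by positivity)]
    calc _ ≤ |θ| * (1 + θ ^ 2 * C) * (C * δ ^ 3) := by
          gcongr
          have : 0 ≤ θ ^ 2 * v := by positivity
          have : θ ^ 2 * v ≤ θ ^ 2 * C := by gcongr
          linarith
      _ = _ := by ring
  have t4 : ‖((θ ^ 2 / 2 * (v - (p * x₁ ^ 2 + (1 - p) * x₀ ^ 2)) : ℝ) : ℂ)‖
      ≤ θ ^ 2 * C * δ ^ 3 * (1 + m) := by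
    rw [Complex.norm_real, Real.norm_eq_abs, abs_mul, abs_of_nonneg (by positivity)]
    calc _ ≤ θ ^ 2 / 2 * (C * δ ^ 3 * (1 + m)) := by gcongr
      _ ≤ _ := by
          have : 0 ≤ θ ^ 2 * (C * δ ^ 3 * (1 + m)) := by positivity
          linarith
  have t5 : ‖((θ ^ 4 * v ^ 2 / 8 : ℝ) : ℂ)‖ ≤ θ ^ 4 * C ^ 2 * δ ^ 3 := by
    rw [Complex.norm_real, Real.norm_of_nonneg (by positivity)]
    have h1 : v ^ 2 ≤ C ^ 2 * δ ^ 3 := by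
      calc v ^ 2 ≤ (C * δ ^ 2) ^ 2 := by gcongr
        _ = C ^ 2 * (δ ^ 3 * δ) := by ring
        _ ≤ C ^ 2 * (δ ^ 3 * 1) := by gcongr
        _ = _ := by ring
    have h2 : 0 ≤ θ ^ 4 * v ^ 2 := by positivity
    calc θ ^ 4 * v ^ 2 / 8 ≤ θ ^ 4 * v ^ 2 := by linarith
      _ ≤ θ ^ 4 * (C ^ 2 * δ ^ 3) := by gcongr
      _ = _ := by ring
  refine (norm_add₃_le).trans ?_
  have t345 := (norm_add_le (((θ * (1 + θ ^ 2 * v / 2) * (p * x₁ + (1 - p) * x₀) : ℝ) : ℂ)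
    * Complex.I) (((θ ^ 2 / 2 * (v - (p * x₁ ^ 2 + (1 - p) * x₀ ^ 2)) : ℝ) : ℂ)
        + ((θ ^ 4 * v ^ 2 / 8 : ℝ) : ℂ)))
  have t45 := (norm_add_le ((θ ^ 2 / 2 * (v - (p * x₁ ^ 2 + (1 - p) * x₀ ^ 2)) : ℝ) : ℂ)
        ((θ ^ 4 * v ^ 2 / 8 : ℝ) : ℂ))
  have p1 : 0 ≤ D ^ 3 * Real.exp D * δ ^ 3 * m := by positivity
  have p2 : 0 ≤ |θ| * C * (1 + θ ^ 2 * C) * δ ^ 3 * m := by positivity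
  have p3 : 0 ≤ θ ^ 4 * C ^ 2 * δ ^ 3 * m := by positivity
  calc _ ≤ p * (D ^ 3 * Real.exp D * δ ^ 3) + (1 - p) * (D ^ 3 * Real.exp D * δ ^ 3)
        + (|θ| * C * (1 + θ ^ 2 * C) * δ ^ 3 + (θ ^ 2 * C * δ ^ 3 * (1 + m)
        + θ ^ 4 * C ^ 2 * δ ^ 3)) := by linarith
    _ ≤ _ := by linarith

end Estimates

section Potentials

lemma dev_one_zero {n : ℕ} (hn : 0 < n) : dev n 1 0 = -(1 / √n) := by
  have hn0 : (0 : ℝ) < n := by exact_mod_cast hn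
  have hsq : √(n : ℝ) * √n = n := Real.mul_self_sqrt hn0.le
  have hsq0 : 0 < √(n : ℝ) := Real.sqrt_pos.2 hn0
  have : dev n 1 0 = -(√n * (1 / n)) := by simp [dev]
  rw [this]
  congr 1
  rw [← mul_div_assoc, mul_one, div_eq_div_iff hn0.ne' hsq0.ne', hsq, one_mul]

lemma dev_sq_step_le {n k a c : ℕ} (hn : 0 < n) (han : a ≤ n) (hc : c ≤ k * n) :
    (a / n : ℝ) * dev n a (c + 1) ^ 2 + (1 - a / n : ℝ) * dev n (a + 1) (c + 1) ^ 2
      ≤ dev n a c ^ 2 + 11 * Real.exp k ^ 2 / n := by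
  have hn0 : (0 : ℝ) < n := by exact_mod_cast hn
  have ha0 : (0 : ℝ) ≤ a / n := by positivity
  have ha1 : (a / n : ℝ) ≤ 1 := by rw [div_le_one hn0]; exact_mod_cast han
  have hsq : √(n : ℝ) * √n = n := Real.mul_self_sqrt hn0.le
  have hsq0 : 0 < √(n : ℝ) := Real.sqrt_pos.2 hn0
  obtain ⟨h1, h2, h3, -, -, -, h7⟩ := dev_step_moments hn han hc
  set B := Real.exp k
  have hB : 0 < B := Real.exp_pos _
  set M := dev n a c
  set x := dev n (a + 1) (c + 1) - M with hx
  set y := dev n a (c + 1) - M with hy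
  set p : ℝ := a / n
  have e1 : dev n (a + 1) (c + 1) = M + x := by rw [hx]; ring
  have e2 : dev n a (c + 1) = M + y := by rw [hy]; ring
  rw [e1, e2]
  have hq : (3 * B / √n) ^ 2 = 9 * B ^ 2 / n := by
    rw [div_pow, pow_two √(n : ℝ), hsq]; ring
  have hx2 : x ^ 2 ≤ 9 * B ^ 2 / n := by
    rw [← hq]; exact sq_le_sq' (by linarith [neg_abs_le x]) ((le_abs_self x).trans h2)
  have hy2 : y ^ 2 ≤ 9 * B ^ 2 / n := by
    rw [← hq]; exact sq_le_sq' (by linarith [neg_abs_le y]) ((le_abs_self y).trans h3)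
  have hcross : M * ((1 - p) * x + p * y) ≤ B ^ 2 / n := by
    refine (le_abs_self _).trans ?_
    rw [abs_mul]
    calc _ ≤ B * √n * (B / (n * √n)) := by gcongr
      _ = B ^ 2 / n := by field_simp
  have hx3 : (1 - p) * x ^ 2 ≤ (1 - p) * (9 * B ^ 2 / n) :=
    mul_le_mul_of_nonneg_left hx2 (by linarith)
  have hy3 : p * y ^ 2 ≤ p * (9 * B ^ 2 / n) := by gcongr
  have : 11 * B ^ 2 / n = 9 * B ^ 2 / n + 2 * (B ^ 2 / n) := by ring
  rw [this]
  linear_combination 2 * hcross + hx3 + hy3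

variable {n k : ℕ}

theorem avg_dev_sq_le (hn : 0 < n) (v₀ : Fin n) :
    avg (fun f : Fin n × Fin k → Fin n =>
      dev n (reachFrom f {v₀}).card (k * (reachFrom f {v₀}).card) ^ 2)
      ≤ 1 + 11 * Real.exp k ^ 2 * k := by
  have hn0 : (0 : ℝ) < n := by exact_mod_cast hn
  have hn1 : (1 : ℝ) ≤ n := by exact_mod_cast hn
  have := avg_card_reachFrom_le (k := k) hn v₀
    (fun a c => dev n a c ^ 2 + 11 * Real.exp k ^ 2 / n * (k * n - c))
    (fun a => dev n a (k * a) ^ 2) ?_ ?_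
  · refine this.trans ?_
    simp only [dev_one_zero hn]
    have h1 : (-(1 / √(n : ℝ))) ^ 2 ≤ 1 := by
      rw [neg_sq, div_pow, Real.sq_sqrt hn0.le, one_pow, div_le_one hn0]
      exact hn1
    have h2 : 11 * Real.exp k ^ 2 / n * (k * n - (0 : ℕ)) = 11 * Real.exp k ^ 2 * k := by
      push_cast
      field_simp
      ring
    rw [h2]
    gcongr
  · intro a c _ han hc
    have hcn : c ≤ k * n := hc.le.trans (by gcongr)
    have := dev_sq_step_le hn han hcn
    push_cast
    have e : 11 * Real.exp k ^ 2 / n * (k * n - c)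
      = 11 * Real.exp k ^ 2 / n * (k * n - (c + 1)) + 11 * Real.exp k ^ 2 / n := by ring
    rw [e]
    linear_combination this
  · intro a _ han
    have : (a : ℝ) ≤ n := by exact_mod_cast han
    have : 0 ≤ (k * n - (k * a : ℕ) : ℝ) := by
      push_cast
      rw [← mul_sub]
      exact mul_nonneg (by positivity) (by linarith)
    have : 0 ≤ 11 * Real.exp k ^ 2 / n * (k * n - (k * a : ℕ)) := by positivity
    linarith

/-- The exponential martingale of the exploration. -/
noncomputable def expDev (n : ℕ) (θ : ℝ) (a c : ℕ) : ℂ :=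
  Complex.exp (θ * dev n a c * Complex.I + θ ^ 2 * devVar (c / n) / 2)

lemma norm_expDev (n : ℕ) (θ : ℝ) (a c : ℕ) :
    ‖expDev n θ a c‖ = Real.exp (θ ^ 2 * devVar (c / n) / 2) := by
  rw [expDev, Complex.norm_exp]
  congr 1
  have : (θ * dev n a c * Complex.I + θ ^ 2 * devVar (c / n) / 2 : ℂ)
    = ((θ * dev n a c : ℝ) : ℂ) * Complex.I + ((θ ^ 2 * devVar (c / n) / 2 : ℝ) : ℂ) := by
    push_cast; ring
  rw [this, Complex.add_re, Complex.re_ofReal_mul, Complex.I_re, mul_zero, zero_add,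
    Complex.ofReal_re]

/-- The constant of `norm_two_point_charFun_sub_one_le`. -/
noncomputable def charFunConst (C θ : ℝ) : ℝ :=
  (C * (|θ| + θ ^ 2)) ^ 3 * Real.exp (C * (|θ| + θ ^ 2)) + |θ| * C * (1 + θ ^ 2 * C)
    + θ ^ 2 * C + θ ^ 4 * C ^ 2

lemma norm_expDev_step_le {a c : ℕ} (θ : ℝ) (hn : 0 < n) (han : a ≤ n) (hc : c ≤ k * n) :
    ‖((a / n : ℝ) : ℂ) * expDev n θ a (c + 1)
      + ((1 - a / n : ℝ) : ℂ) * expDev n θ (a + 1) (c + 1) - expDev n θ a c‖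
    ≤ 2 * Real.exp (θ ^ 2 * Real.exp k / 2) * charFunConst (32 * Real.exp k ^ 2) θ
      * (1 / √n) ^ 3 * (1 + dev n a c ^ 2) := by
  have hn0 : (0 : ℝ) < n := by exact_mod_cast hn
  have hn1 : (1 : ℝ) ≤ n := by exact_mod_cast hn
  have ha0 : (0 : ℝ) ≤ a / n := by positivity
  have ha1 : (a / n : ℝ) ≤ 1 := by rw [div_le_one hn0]; exact_mod_cast han
  have hsq : √(n : ℝ) * √n = n := Real.mul_self_sqrt hn0.le
  have hsq0 : 0 < √(n : ℝ) := Real.sqrt_pos.2 hn0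
  have hsq1 : 1 ≤ √(n : ℝ) := by rw [Real.one_le_sqrt]; exact hn1
  obtain ⟨h1, h2, h3, h4, h5, h6, -⟩ := dev_step_moments hn han hc
  have hB1 : 1 ≤ Real.exp k := Real.one_le_exp (by positivity)
  have hδ3 : (1 / √(n : ℝ)) ^ 3 = 1 / (n * √n) := by
    rw [div_pow, one_pow, pow_succ, pow_two, hsq]
  have hδ2 : (1 / √(n : ℝ)) ^ 2 = 1 / n := by
    rw [div_pow, one_pow, pow_two, hsq]
  set B := Real.exp k with hB
  have hBB : B ≤ B ^ 2 := by rw [pow_two]; exact le_mul_of_one_le_left (by linarith) hB1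
  set x := dev n (a + 1) (c + 1) - dev n a c with hx
  set y := dev n a (c + 1) - dev n a c with hy
  set v := devVar ((c + 1 : ℕ) / n) - devVar (c / n) with hv
  have e1 : expDev n θ (a + 1) (c + 1)
      = expDev n θ a c * Complex.exp (θ * x * Complex.I + θ ^ 2 * v / 2) := by
    rw [expDev, expDev, ← Complex.exp_add, hx, hv]
    congr 1
    push_cast
    ring
  have e0 : expDev n θ a (c + 1)
      = expDev n θ a c * Complex.exp (θ * y * Complex.I + θ ^ 2 * v / 2) := by
    rw [expDev, expDev, ← Complex.exp_add, hy, hv]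
    congr 1
    push_cast
    ring
  have hp : ((a / n : ℝ) : ℂ) = ((1 - (1 - a / n : ℝ) : ℝ) : ℂ) := by congr 1; ring
  have key := norm_two_point_charFun_sub_one_le (θ := θ) (C := 32 * B ^ 2)
    (p := 1 - a / n) (x₁ := x) (x₀ := y) (v := v) (δ := 1 / √n) (m := |dev n a c|)
    (by positivity) (by linarith) (by linarith) (by positivity)
    (by rw [div_le_one hsq0]; exact hsq1) (abs_nonneg _)
    (by
      rw [hδ3, sub_sub_cancel]
      refine h1.trans ?_
      rw [div_eq_mul_one_div]
      gcongr
      linarith)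
    (by
      refine h2.trans ?_
      rw [div_eq_mul_one_div]
      gcongr
      linarith)
    (by
      refine h3.trans ?_
      rw [div_eq_mul_one_div]
      gcongr
      linarith)
    h4
    (by
      rw [hδ2]
      refine h5.trans ?_
      rw [div_eq_mul_one_div]
      gcongr
      linarith)
    (by
      rw [hδ3, sub_sub_cancel]
      refine h6.trans (le_of_eq ?_)
      ring)
  have hK : 0 ≤ charFunConst (32 * B ^ 2) θ := by unfold charFunConst; positivity
  have hfac : ((a / n : ℝ) : ℂ) * expDev n θ a (c + 1)
      + ((1 - a / n : ℝ) : ℂ) * expDev n θ (a + 1) (c + 1) - expDev n θ a c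
      = expDev n θ a c * (((1 - a / n : ℝ) : ℂ)
        * Complex.exp (θ * x * Complex.I + θ ^ 2 * v / 2)
        + ((1 - (1 - a / n : ℝ) : ℝ) : ℂ)
        * Complex.exp (θ * y * Complex.I + θ ^ 2 * v / 2) - 1) := by
    rw [e1, e0, hp]
    ring
  rw [hfac, norm_mul, norm_expDev]
  have hVB : devVar (c / n) ≤ B := by
    have : (c / n : ℝ) ≤ k := by rw [div_le_iff₀ hn0]; exact_mod_cast hc
    have := Real.exp_le_exp.2 this
    have : (0 : ℝ) ≤ c / n := by positivity
    unfold devVar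
    linarith
  have hM : 1 + |dev n a c| ≤ 2 * (1 + dev n a c ^ 2) := by
    rw [← sq_abs (dev n a c)]
    nlinarith [sq_nonneg (|dev n a c| - 1), sq_nonneg (|dev n a c|)]
  calc _ ≤ Real.exp (θ ^ 2 * B / 2) * (charFunConst (32 * B ^ 2) θ * (1 / √n) ^ 3
        * (1 + |dev n a c|)) := by
        gcongr
        exact key
    _ ≤ Real.exp (θ ^ 2 * B / 2) * (charFunConst (32 * B ^ 2) θ * (1 / √n) ^ 3
        * (2 * (1 + dev n a c ^ 2))) := by gcongr
    _ = _ := by ring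

theorem exists_norm_avg_expDev_sub_one_le (k : ℕ) (θ : ℝ) :
    ∃ K : ℝ, ∀ n : ℕ, 0 < n → ∀ v₀ : Fin n,
      ‖avg (fun f : Fin n × Fin k → Fin n =>
        expDev n θ (reachFrom f {v₀}).card (k * (reachFrom f {v₀}).card)) - 1‖ ≤ K / √n := by
  set K₁ := 2 * Real.exp (θ ^ 2 * Real.exp k / 2) * charFunConst (32 * Real.exp k ^ 2) θ
  set D := 11 * Real.exp k ^ 2 with hD
  have hD0 : 0 ≤ D := by positivity
  have hK₁ : 0 ≤ K₁ := by
    have : 0 ≤ charFunConst (32 * Real.exp k ^ 2) θ := by unfold charFunConst; positivity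
    positivity
  refine ⟨K₁ * k * (2 + D * k) + |θ|, fun n hn v₀ => ?_⟩
  have hn0 : (0 : ℝ) < n := by exact_mod_cast hn
  have hn1 : (1 : ℝ) ≤ n := by exact_mod_cast hn
  have hsq : √(n : ℝ) * √n = n := Real.mul_self_sqrt hn0.le
  have hsq0 : 0 < √(n : ℝ) := Real.sqrt_pos.2 hn0
  have main := norm_avg_card_reachFrom_sub_le (k := k) hn v₀ (expDev n θ)
    (fun a c => K₁ * (1 / √n) ^ 3 * (k * n - c) * (1 + dev n a c ^ 2 + D / n * (k * n - c)))
    ?_ ?_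
  · have h1 : ‖expDev n θ 1 0 - 1‖ ≤ |θ| / √n := by
      have : expDev n θ 1 0 = Complex.exp (Complex.I * (θ * dev n 1 0 : ℝ)) := by
        simp only [expDev, devVar]
        congr 1
        push_cast
        simp
        ring
      rw [this]
      refine (Real.norm_exp_I_mul_ofReal_sub_one_le).trans (le_of_eq ?_)
      rw [dev_one_zero hn, Real.norm_eq_abs, abs_mul, abs_neg, abs_of_nonneg (a := 1 / √(n : ℝ))
        (by positivity)]
      ring
    have h2 : K₁ * (1 / √n) ^ 3 * (k * n - (0 : ℕ))
        * (1 + dev n 1 0 ^ 2 + D / n * (k * n - (0 : ℕ))) ≤ K₁ * k * (2 + D * k) / √n := by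
      have h3 : dev n 1 0 ^ 2 ≤ 1 := by
        rw [dev_one_zero hn, neg_sq, div_pow, Real.sq_sqrt hn0.le, one_pow, div_le_one hn0]
        exact hn1
      have h4 : (1 / √(n : ℝ)) ^ 3 * n = 1 / √n := by
        rw [div_pow, one_pow, pow_succ, pow_two, hsq]
        field_simp
      calc _ = K₁ * k * ((1 / √(n : ℝ)) ^ 3 * n) * (1 + dev n 1 0 ^ 2 + D * k) := by
            push_cast
            field_simp
            ring
        _ = K₁ * k * (1 / √(n : ℝ)) * (1 + dev n 1 0 ^ 2 + D * k) := by rw [h4]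
        _ ≤ K₁ * k * (1 / √(n : ℝ)) * (1 + 1 + D * k) := by gcongr
        _ = _ := by ring
    calc _ ≤ ‖avg (fun f : Fin n × Fin k → Fin n =>
          expDev n θ (reachFrom f {v₀}).card (k * (reachFrom f {v₀}).card)) - expDev n θ 1 0‖
          + ‖expDev n θ 1 0 - 1‖ := norm_sub_le_norm_sub_add_norm_sub _ _ _
      _ ≤ K₁ * k * (2 + D * k) / √n + |θ| / √n := add_le_add (main.trans h2) h1
      _ = _ := by ring
  · intro a c _ han hc
    have hcn : c + 1 ≤ k * n := hc.trans_le (by gcongr)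
    have hcn' : ((c : ℝ) + 1) ≤ k * n := by exact_mod_cast hcn
    have s1 := norm_expDev_step_le θ hn han (Nat.le_of_succ_le hcn)
    have s2 := dev_sq_step_le hn han (Nat.le_of_succ_le hcn)
    rw [← hD] at s2
    push_cast at s1 s2 ⊢
    set r := K₁ * (1 / √(n : ℝ)) ^ 3 with hr
    have hr0 : 0 ≤ r := by positivity
    obtain ⟨N, hN⟩ : ∃ N : ℝ, N = k * n - (c + 1) := ⟨_, rfl⟩
    have hN0 : 0 ≤ N := by linarith
    have hN' : (k * n - c : ℝ) = N + 1 := by rw [hN]; ring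
    rw [← hN, hN']
    set M := dev n a c
    set p : ℝ := a / n
    have hDn : 0 ≤ D / n := by positivity
    have s3 : r * N * (p * dev n a (c + 1) ^ 2 + (1 - p) * dev n (a + 1) (c + 1) ^ 2)
        ≤ r * N * (M ^ 2 + D / n) := by gcongr
    have s4 : 0 ≤ r * (D / n * (N + 1)) := by positivity
    linear_combination s1 + s3 + s4
  · intro a _ han
    have h1 : (a : ℝ) ≤ n := by exact_mod_cast han
    have h2 : 0 ≤ (k * n - (k * a : ℕ) : ℝ) := by
      push_cast
      rw [← mul_sub]
      exact mul_nonneg (by positivity) (by linarith)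
    positivity

/-- It is unlikely that few vertices are reachable from a given vertex. -/
theorem avg_card_reachFrom_small_le (hk : 2 ≤ k) (hn : 0 < n) (v₀ : Fin n) {z : ℝ}
    (hz : 2 ≤ z) :
    avg (fun f : Fin n × Fin k → Fin n =>
      if ((reachFrom f {v₀}).card : ℝ) ≤ n / (2 * z) then (1 : ℝ) else 0) ≤ 1 / z ^ 2 := by
  have hn0 : (0 : ℝ) < n := by exact_mod_cast hn
  have hz0 : 0 < z := by linarith
  have main := avg_card_reachFrom_le (k := k) hn v₀
    (fun a c => if (a : ℝ) ≤ n / (2 * z) then z ^ ((c : ℤ) - 2 * a) else 0)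
    (fun a => if (a : ℝ) ≤ n / (2 * z) then (1 : ℝ) else 0) ?_ ?_
  · refine main.trans ?_
    split_ifs
    · simp [zpow_neg]
    · positivity
  · intro a c _ han hc
    have hp0 : (0 : ℝ) ≤ a / n := by positivity
    have hp1 : (a / n : ℝ) ≤ 1 := by rw [div_le_one hn0]; exact_mod_cast han
    by_cases ha : (a : ℝ) ≤ n / (2 * z)
    · rw [if_pos ha, if_pos ha]
      have hu : 0 < z ^ ((c : ℤ) - 2 * a) := by positivity
      have e1 : z ^ (((c + 1 : ℕ) : ℤ) - 2 * a) = z ^ ((c : ℤ) - 2 * a) * z := by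
        rw [← zpow_add_one₀ hz0.ne']
        congr 1
        push_cast
        ring
      have e2 : z ^ (((c + 1 : ℕ) : ℤ) - 2 * ((a + 1 : ℕ) : ℤ)) = z ^ ((c : ℤ) - 2 * a) * z⁻¹ := by
        rw [← zpow_sub_one₀ hz0.ne']
        congr 1
        push_cast
        ring
      have h1 : (a / n : ℝ) * z ≤ 1 / 2 := by
        rw [le_div_iff₀ (by positivity)] at ha
        rw [div_mul_eq_mul_div, div_le_iff₀ hn0]
        linarith
      have h2 : z⁻¹ ≤ 1 / 2 := by
        rw [inv_le_comm₀ hz0 (by norm_num)]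
        simpa using hz
      have h3 : (if ((a + 1 : ℕ) : ℝ) ≤ n / (2 * z)
          then z ^ (((c + 1 : ℕ) : ℤ) - 2 * ((a + 1 : ℕ) : ℤ)) else 0)
          ≤ z ^ ((c : ℤ) - 2 * a) * (1 / 2) := by
        split_ifs
        · rw [e2]
          gcongr
        · positivity
      calc _ ≤ (a / n : ℝ) * (z ^ ((c : ℤ) - 2 * a) * z)
            + (1 - a / n : ℝ) * (z ^ ((c : ℤ) - 2 * a) * (1 / 2)) := by
            rw [e1]
            have : (0 : ℝ) ≤ 1 - a / n := by linarith
            gcongr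
        _ = z ^ ((c : ℤ) - 2 * a) * ((a / n : ℝ) * z + (1 - a / n : ℝ) * (1 / 2)) := by ring
        _ ≤ z ^ ((c : ℤ) - 2 * a) * 1 := by
            gcongr
            linarith
        _ = _ := mul_one _
    · have ha' : ¬ (((a + 1 : ℕ) : ℝ) ≤ n / (2 * z)) := by
        push_cast
        linarith
      rw [if_neg ha, if_neg ha', if_neg ha]
      simp
  · intro a _ _
    split_ifs
    · apply one_le_zpow₀ (by linarith)
      push_cast
      have : (2 : ℤ) ≤ k := by exact_mod_cast hk
      nlinarith
    · exact le_rfl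

/-- Once linearly many vertices have been reached from `v₀`, exploring from one more vertex is a
subcritical process, so it is unlikely to discover `L` new vertices. -/
theorem avg_card_reachFrom_pair_le (hn : 0 < n) (v₀ v : Fin n) {γ lam L : ℝ} (hlam : 0 ≤ lam)
    (hη : k * ((1 - γ) * (Real.exp lam - 1)) ≤ lam) (hL : 0 < L) :
    avg (fun f : Fin n × Fin k → Fin n =>
      if γ * n ≤ (reachFrom f {v₀}).card ∧
        ((reachFrom f {v₀}).card : ℝ) + L ≤ (reachFrom f ({v₀} ∪ {v})).card
      then (1 : ℝ) else 0)
      ≤ Real.exp (lam - (lam - k * ((1 - γ) * (Real.exp lam - 1))) * L) := by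
  have hn0 : (0 : ℝ) < n := by exact_mod_cast hn
  set μ := (1 - γ) * (Real.exp lam - 1) with hμ
  set η := lam - k * μ with hηdef
  have hη0 : 0 ≤ η := by linarith
  have hE : 0 ≤ Real.exp lam - 1 := by linarith [Real.one_le_exp hlam]
  refine avg_le_of_supermartingale hn v₀ (fun _ _ => Real.exp (lam - η * L)) _ ?_ ?_
  · intro a c _ _ _
    exact le_of_eq (by ring)
  · intro A g hA hg hr
    have hpos : (0 : ℝ) ≤ Real.exp (lam - η * L) := (Real.exp_pos _).le
    have hu : ∀ h, reachFrom ((A ×ˢ Finset.univ).piecewise g h) ({v₀} ∪ {v})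
        = reachFrom ((A ×ˢ Finset.univ).piecewise g h) (A ∪ {v}) := by
      intro h
      rw [← reachFrom_union_eq, hr h]
    by_cases hbig : γ * n ≤ A.card
    swap
    · rw [condAvg_const hn _ _ (y := 0) fun h => by rw [hr]; simp [hbig]]
      exact hpos
    by_cases hvA : v ∈ A
    · have hAv : A ∪ {v} = A := by simpa using hvA
      have h0 : ∀ h, ¬ ((reachFrom ((A ×ˢ Finset.univ).piecewise g h) {v₀}).card + L
          ≤ ((reachFrom ((A ×ˢ Finset.univ).piecewise g h) ({v₀} ∪ {v})).card : ℝ)) := by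
        intro h
        rw [hu, hAv, hr]
        have : reachFrom ((A ×ˢ Finset.univ).piecewise g h) A = A :=
          Finset.Subset.antisymm (reachFrom_subset_of_closed subset_rfl fun v hv i => by
            simpa [Finset.piecewise, hv] using hg v hv i) (subset_reachFrom _ _)
        rw [this]
        linarith
      rw [condAvg_const hn _ _ (y := 0) fun h => if_neg fun hh => h0 h hh.2]
      exact hpos
    · have hcard : (A ∪ {v}).card = A.card + 1 := by
        rw [Finset.card_union_of_disjoint (by simpa using hvA), Finset.card_singleton]
      have hCcard : (A ×ˢ (Finset.univ : Finset (Fin k))).card = k * A.card := by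
        simp [Finset.card_product, mul_comm]
      have main := condAvg_le_of_supermartingale (k := k) hn (A ∪ {v})
        (fun a c => Real.exp (-(η * L) + lam * (a - A.card) - μ * (c - k * A.card)))
        (fun f => if (A.card : ℝ) + L ≤ (reachFrom f (A ∪ {v})).card then (1 : ℝ) else 0)
        ?_ ?_ (A ∪ {v}) (A ×ˢ Finset.univ) g subset_rfl
        (Finset.product_subset_product_left Finset.subset_union_left)
        (fun x hx => Finset.mem_union_left _ (by
          obtain ⟨x1, x2⟩ := x
          exact hg x1 (by simpa using hx) x2))
        (fun h => subset_reachFrom _ _)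
      · refine (condAvg_mono fun h => ?_).trans (main.trans (le_of_eq ?_))
        · rw [hu, hr]
          simp [hbig]
        · rw [hcard, hCcard]
          congr 1
          push_cast
          ring
      · intro a c ha han _
        rw [hcard] at ha
        set u := Real.exp (-(η * L) + lam * (a - A.card) - μ * (c - k * A.card)) with hudef
        have hu0 : 0 < u := Real.exp_pos _
        have e1 : Real.exp (-(η * L) + lam * (a - A.card) - μ * ((c + 1 : ℕ) - k * A.card))
            = u * Real.exp (-μ) := by
          rw [hudef, ← Real.exp_add]
          congr 1
          push_cast
          ring
        have e2 : Real.exp (-(η * L) + lam * ((a + 1 : ℕ) - A.card)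
            - μ * ((c + 1 : ℕ) - k * A.card)) = u * Real.exp (-μ) * Real.exp lam := by
          rw [hudef, ← Real.exp_add, ← Real.exp_add]
          congr 1
          push_cast
          ring
        have haγ : γ ≤ a / n := by
          rw [le_div_iff₀ hn0]
          have : (A.card : ℝ) ≤ a := by exact_mod_cast (Nat.le_succ _).trans ha
          linarith
        rw [e1, e2]
        calc _ = u * Real.exp (-μ) * (1 + (1 - a / n : ℝ) * (Real.exp lam - 1)) := by ring
          _ ≤ u * Real.exp (-μ) * (1 + μ) := by
              rw [hμ]
              gcongr
          _ ≤ u * Real.exp (-μ) * Real.exp μ := by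
              gcongr
              linarith [Real.add_one_le_exp μ]
          _ = u := by rw [mul_assoc, ← Real.exp_add]; simp
      · intro A' g' _ _ hr'
        rw [condAvg_const hn _ _ (y := if (A.card : ℝ) + L ≤ A'.card then (1 : ℝ) else 0)
          fun h => by rw [hr']]
        split_ifs with hAL
        · apply Real.one_le_exp
          have : -(η * L) + lam * (A'.card - A.card) - μ * ((k * A'.card : ℕ) - k * A.card)
              = η * (A'.card - (A.card + L)) := by
            rw [hηdef]
            push_cast
            ring
          rw [this]
          exact mul_nonneg hη0 (by linarith)
        · exact (Real.exp_pos _).le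

end Potentials

section Limits

open scoped Topology

/-- The law of `W` under the uniform measure. -/
noncomputable def avgLaw {α : Type*} [Fintype α] (W : α → ℝ) : Measure ℝ :=
  ∑ a, ENNReal.ofReal (Fintype.card α : ℝ)⁻¹ • Measure.dirac (W a)

section AvgLaw

variable {α : Type*} [Fintype α]

instance [Nonempty α] (W : α → ℝ) : IsProbabilityMeasure (avgLaw W) := by
  constructor
  have h : (0 : ℝ) < Fintype.card α := by exact_mod_cast Fintype.card_pos
  have : (Fintype.card α : ENNReal) = ENNReal.ofReal (Fintype.card α : ℝ) := by simp
  simp only [avgLaw, Measure.coe_finsetSum, Finset.sum_apply, Measure.smul_apply, measure_univ,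
    smul_eq_mul, mul_one, Finset.sum_const, Finset.card_univ, nsmul_eq_mul]
  rw [this, ← ENNReal.ofReal_mul h.le, mul_inv_cancel₀ h.ne', ENNReal.ofReal_one]

lemma charFun_avgLaw (W : α → ℝ) (θ : ℝ) :
    charFun (avgLaw W) θ = avg fun a => Complex.exp (θ * W a * Complex.I) := by
  have hm : StronglyMeasurable fun x : ℝ => Complex.exp (θ * x * Complex.I) := by
    apply Continuous.stronglyMeasurable
    fun_prop
  rw [charFun_apply_real, avgLaw, integral_finsetSum_measure]
  · simp only [integral_smul_measure, integral_dirac' _ _ hm, avg, Finset.smul_sum]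
    rw [ENNReal.toReal_ofReal (by positivity)]
  · intro a _
    apply Integrable.smul_measure _ ENNReal.ofReal_ne_top
    refine (integrable_const (1 : ℝ)).mono hm.aestronglyMeasurable (ae_of_all _ fun x => ?_)
    have : (θ * x * Complex.I : ℂ) = ((θ * x : ℝ) : ℂ) * Complex.I := by push_cast; ring
    rw [this, Complex.norm_exp_ofReal_mul_I]
    simp

lemma avgLaw_Iic (W : α → ℝ) (x : ℝ) :
    (avgLaw W (Set.Iic x)).toReal = avg fun a => if W a ≤ x then (1 : ℝ) else 0 := by
  simp only [avgLaw, Measure.coe_finsetSum, Finset.sum_apply, Measure.smul_apply, smul_eq_mul,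
    Measure.dirac_apply' _ measurableSet_Iic, avg]
  rw [ENNReal.toReal_sum, Finset.mul_sum]
  · refine Finset.sum_congr rfl fun a _ => ?_
    rw [ENNReal.toReal_mul, ENNReal.toReal_ofReal (by positivity)]
    by_cases h : W a ≤ x <;> simp [h]
  · intro a _
    by_cases h : W a ≤ x <;> simp [h]

end AvgLaw

/-- The distribution function of the standard normal law. -/
noncomputable def normalCDF (x : ℝ) : ℝ :=
  (√(2 * Real.pi))⁻¹ * ∫ t in Set.Iic x, Real.exp (-t ^ 2 / 2)

lemma gaussianReal_Iic (x : ℝ) :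
    (ProbabilityTheory.gaussianReal 0 1 (Set.Iic x)).toReal = normalCDF x := by
  rw [ProbabilityTheory.gaussianReal_apply_eq_integral _ one_ne_zero, ENNReal.toReal_ofReal
    (integral_nonneg fun t => ProbabilityTheory.gaussianPDFReal_nonneg _ _ _), normalCDF,
    ← integral_const_mul]
  simp [ProbabilityTheory.gaussianPDFReal]

/-- Lévy's continuity theorem for uniform measures on finite types. -/
theorem tendsto_avg_ite_le {α : ℕ → Type*} [∀ n, Fintype (α n)] [∀ n, Nonempty (α n)]
    (W : ∀ n, α n → ℝ)
    (hW : ∀ θ : ℝ, Tendsto (fun n => avg fun a => Complex.exp (θ * W n a * Complex.I)) atTop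
      (𝓝 (Complex.exp (-(θ ^ 2 / 2)))))
    {y : ℕ → ℝ} {x : ℝ} (hy : Tendsto y atTop (𝓝 x)) :
    Tendsto (fun n => avg fun a => if W n a ≤ y n then (1 : ℝ) else 0) atTop
      (𝓝 (normalCDF x)) := by
  let μ : ℕ → ProbabilityMeasure ℝ := fun n => ⟨avgLaw fun a => W n a + (x - y n), inferInstance⟩
  let μ₀ : ProbabilityMeasure ℝ := ⟨ProbabilityTheory.gaussianReal 0 1, inferInstance⟩
  have hlim : Tendsto μ atTop (𝓝 μ₀) := by
    rw [ProbabilityMeasure.tendsto_iff_tendsto_charFun]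
    intro θ
    have h0 : charFun (μ₀ : Measure ℝ) θ = Complex.exp (-(θ ^ 2 / 2)) := by
      simp only [μ₀, ProbabilityMeasure.coe_mk, ProbabilityTheory.charFun_gaussianReal]
      congr 1
      simp
    have hn : ∀ n, charFun (μ n : Measure ℝ) θ
        = Complex.exp (θ * (x - y n : ℝ) * Complex.I)
          * avg fun a => Complex.exp (θ * W n a * Complex.I) := by
      intro n
      simp only [μ, ProbabilityMeasure.coe_mk, charFun_avgLaw]
      rw [← avg_complex_mul_left]
      congr 1
      funext a
      rw [← Complex.exp_add]
      congr 1
      push_cast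
      ring
    rw [h0]
    simp only [hn]
    have h1 : Tendsto (fun n => Complex.exp (θ * (x - y n : ℝ) * Complex.I)) atTop (𝓝 1) := by
      have hc : Continuous fun t : ℝ => Complex.exp (θ * (x - t : ℝ) * Complex.I) := by fun_prop
      simpa [Function.comp_def] using (hc.tendsto x).comp hy
    simpa using h1.mul (hW θ)
  have hfr : (μ₀ : Measure ℝ) (frontier (Set.Iic x)) = 0 := by
    rw [frontier_Iic]
    simp only [μ₀, ProbabilityMeasure.coe_mk]
    have := ProbabilityTheory.nullSingletonClass_gaussianReal (μ := 0) (v := 1) one_ne_zero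
    exact measure_singleton x
  have h2 := ProbabilityMeasure.tendsto_measure_of_null_frontier_of_tendsto' hlim hfr
  have h3 := (ENNReal.tendsto_toReal (measure_ne_top _ _)).comp h2
  simp only [μ₀, ProbabilityMeasure.coe_mk, gaussianReal_Iic] at h3
  refine h3.congr fun n => ?_
  simp only [μ, Function.comp, ProbabilityMeasure.coe_mk, avgLaw_Iic]
  congr 1
  funext a
  congr 1
  apply propext
  constructor <;> intro h <;> linarith

end Limits

section Drift

/-- The deterministic limit profile of the exploration at its end. -/
noncomputable def drift (κ α : ℝ) : ℝ := (1 - α) * Real.exp (κ * α)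

lemma dev_eq_drift (n k a : ℕ) : dev n a (k * a) = √n * (drift k (a / n) - 1) := by
  simp only [dev, drift]
  push_cast
  rw [mul_div_assoc]

lemma continuous_drift (κ : ℝ) : Continuous (drift κ) := by
  unfold drift
  fun_prop

lemma hasDerivAt_drift (κ α : ℝ) :
    HasDerivAt (drift κ) (Real.exp (κ * α) * (κ * (1 - α) - 1)) α := by
  have h1 : HasDerivAt (fun t : ℝ => 1 - t) (-1) α := by
    simpa using (hasDerivAt_id α).const_sub 1
  have h2 : HasDerivAt (fun t : ℝ => Real.exp (κ * t)) (Real.exp (κ * α) * κ) α := by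
    simpa using ((hasDerivAt_id α).const_mul κ).exp
  refine (h1.mul h2).congr_deriv ?_
  ring

lemma strictMonoOn_drift {κ : ℝ} (hκ : 0 < κ) :
    StrictMonoOn (drift κ) (Set.Iic (1 - 1 / κ)) := by
  refine strictMonoOn_of_deriv_pos (convex_Iic _) (continuous_drift κ).continuousOn fun t ht => ?_
  rw [interior_Iic, Set.mem_Iio] at ht
  rw [(hasDerivAt_drift κ t).deriv]
  have h1 : 1 / κ < 1 - t := by linarith
  rw [div_lt_iff₀ hκ] at h1
  have : 0 < κ * (1 - t) - 1 := by linarith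
  positivity

lemma strictAntiOn_drift {κ : ℝ} (hκ : 0 < κ) :
    StrictAntiOn (drift κ) (Set.Ici (1 - 1 / κ)) := by
  refine strictAntiOn_of_deriv_neg (convex_Ici _) (continuous_drift κ).continuousOn fun t ht => ?_
  rw [interior_Ici, Set.mem_Ioi] at ht
  rw [(hasDerivAt_drift κ t).deriv]
  have h1 : 1 - t < 1 / κ := by linarith
  rw [lt_div_iff₀ hκ] at h1
  exact mul_neg_of_pos_of_neg (Real.exp_pos _) (by linarith)

lemma devVar_pos {s : ℝ} (hs : s ≠ 0) : 0 < devVar s := by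
  unfold devVar
  linarith [Real.add_one_lt_exp hs]

variable {κ τ : ℝ}

lemma sub_one_lt_of_root (hκ : 0 < κ) (hτ0 : 0 < τ) (hτ : 1 - τ / κ - Real.exp (-τ) = 0) :
    κ - 1 < τ := by
  have h1 : κ * Real.exp (-τ) = κ - τ := by
    have : κ * (τ / κ) = τ := mul_div_cancel₀ _ hκ.ne'
    linear_combination -κ * hτ - this
  have h2 : Real.exp (-τ) * Real.exp τ = 1 := by rw [← Real.exp_add]; simp
  have h3 : (κ - τ) * (Real.exp τ - 1) = τ := by
    linear_combination -Real.exp τ * h1 + κ * h2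
  have h4 := Real.add_one_lt_exp hτ0.ne'
  nlinarith

lemma root_lt (hτ : 1 - τ / κ - Real.exp (-τ) = 0) : τ / κ < 1 := by
  linarith [Real.exp_pos (-τ)]

lemma one_sub_lt_root_div (hκ : 0 < κ) (hτ0 : 0 < τ) (hτ : 1 - τ / κ - Real.exp (-τ) = 0) :
    1 - 1 / κ < τ / κ := by
  have := sub_one_lt_of_root hκ hτ0 hτ
  have e : 1 - 1 / κ = (κ - 1) / κ := by field_simp
  rw [e]
  gcongr

lemma drift_root (hκ : 0 < κ) (hτ : 1 - τ / κ - Real.exp (-τ) = 0) : drift κ (τ / κ) = 1 := by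
  have h1 : κ * (τ / κ) = τ := mul_div_cancel₀ _ hκ.ne'
  have h2 : 1 - τ / κ = Real.exp (-τ) := by linarith
  rw [drift, h1, h2, ← Real.exp_add]
  simp

lemma eq_root_of_drift_eq_one (hκ : 0 < κ) (hτ0 : 0 < τ)
    (hτ : 1 - τ / κ - Real.exp (-τ) = 0) {α : ℝ} (hα : 0 < α) (h : drift κ α = 1) :
    α = τ / κ := by
  have hν := one_sub_lt_root_div hκ hτ0 hτ
  rcases le_total α (1 - 1 / κ) with h1 | h1
  · have := strictMonoOn_drift hκ (hα.le.trans h1 : (0 : ℝ) ∈ Set.Iic (1 - 1 / κ)) h1 hα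
    rw [h] at this
    simp [drift] at this
  · exact (strictAntiOn_drift hκ).injOn h1 hν.le (h.trans (drift_root hκ hτ).symm)

end Drift

section Concentration

open scoped Topology

variable {k : ℕ} {τ : ℝ}

/-- The number of vertices reachable from the vertex `0`. -/
noncomputable def reachCard {n k : ℕ} (f : Fin (n + 1) × Fin k → Fin (n + 1)) : ℕ :=
  (reachFrom f {0}).card

lemma reachCard_div_mem {n k : ℕ} (f : Fin (n + 1) × Fin k → Fin (n + 1)) :
    (reachCard f / (n + 1 : ℕ) : ℝ) ∈ Set.Ioc (0 : ℝ) 1 := by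
  have h1 : 1 ≤ reachCard f := Finset.card_pos.2 ⟨0, subset_reachFrom _ _ (by simp)⟩
  have h2 : reachCard f ≤ n + 1 := by
    simpa [reachCard] using Finset.card_le_univ (reachFrom f {0})
  have h1' : (1 : ℝ) ≤ reachCard f := by exact_mod_cast h1
  have h2' : (reachCard f : ℝ) ≤ (n + 1 : ℕ) := by exact_mod_cast h2
  have h3 : (0 : ℝ) < (n + 1 : ℕ) := by positivity
  exact ⟨by positivity, (div_le_one h3).2 h2'⟩

lemma exists_le_abs_drift_sub_one (hk : 0 < k) (hτ0 : 0 < τ)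
    (hτ : 1 - τ / k - Real.exp (-τ) = 0) {δ ε : ℝ} (hδ : 0 < δ) (hε : 0 < ε) :
    ∃ c > 0, ∀ α ∈ Set.Icc δ 1, ε ≤ |α - τ / k| → c ≤ |drift k α - 1| := by
  have hk0 : (0 : ℝ) < k := by exact_mod_cast hk
  have hcont : Continuous fun α => |drift k α - 1| := by
    have := continuous_drift k
    fun_prop
  have hcomp : IsCompact (Set.Icc δ 1 ∩ {α | ε ≤ |α - τ / k|}) :=
    isCompact_Icc.inter_right (isClosed_le continuous_const (by fun_prop))
  rcases (Set.Icc δ 1 ∩ {α | ε ≤ |α - τ / k|}).eq_empty_or_nonempty with he | hne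
  · refine ⟨1, one_pos, fun α h1 h2 => ?_⟩
    exact absurd (show α ∈ Set.Icc δ 1 ∩ {α | ε ≤ |α - τ / k|} from ⟨h1, h2⟩) (by simp [he])
  · obtain ⟨α₀, ⟨h1, h2⟩, hmin⟩ := hcomp.exists_isMinOn hne hcont.continuousOn
    refine ⟨|drift k α₀ - 1|, ?_, fun α h3 h4 => hmin ⟨h3, h4⟩⟩
    rw [gt_iff_lt, abs_pos]
    intro h
    have := eq_root_of_drift_eq_one hk0 hτ0 hτ (hδ.trans_le h1.1) (sub_eq_zero.1 h)
    simp only [this, sub_self, abs_zero, Set.mem_ofPred_eq] at h2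
    linarith

/-- The fraction of vertices reachable from a given vertex concentrates around `τ / k`. -/
theorem tendsto_avg_abs_reachCard_div_sub (hk : 2 ≤ k) (hτ0 : 0 < τ)
    (hτ : 1 - τ / k - Real.exp (-τ) = 0) {ε : ℝ} (hε : 0 < ε) :
    Tendsto (fun n : ℕ => avg fun f : Fin (n + 1) × Fin k → Fin (n + 1) =>
      if ε ≤ |(reachCard f / (n + 1 : ℕ) : ℝ) - τ / k| then (1 : ℝ) else 0) atTop (𝓝 0) := by
  rw [Metric.tendsto_atTop]
  intro r hr
  obtain ⟨z, hz2, hz⟩ : ∃ z : ℝ, 2 ≤ z ∧ 1 / z ^ 2 < r / 2 := by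
    refine ⟨max 2 (2 / r + 1), le_max_left _ _, ?_⟩
    have h1 : 2 / r < max 2 (2 / r + 1) := (lt_add_one _).trans_le (le_max_right _ _)
    have h2 : (2 : ℝ) ≤ max 2 (2 / r + 1) := le_max_left _ _
    set z := max 2 (2 / r + 1)
    have h3 : 2 / r < z ^ 2 := by nlinarith
    rw [div_lt_iff₀ hr] at h3
    rw [div_lt_iff₀ (by positivity)]
    linarith
  have hz0 : 0 < z := by linarith
  obtain ⟨c, hc, hcle⟩ := exists_le_abs_drift_sub_one (k := k) (by omega) hτ0 hτ
    (show 0 < 1 / (2 * z) by positivity) hε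
  set K := 1 + 11 * Real.exp k ^ 2 * k with hK
  have hK0 : 0 < K := by positivity
  obtain ⟨N, hN⟩ := exists_nat_gt (2 * K / (r * c ^ 2))
  refine ⟨N, fun n hn => ?_⟩
  have hn0 : (0 : ℝ) < (n + 1 : ℕ) := by positivity
  have hbound : 1 / ((n + 1 : ℕ) * c ^ 2) * K < r / 2 := by
    have h1 : 2 * K / (r * c ^ 2) < (n + 1 : ℕ) :=
      hN.trans (by exact_mod_cast Nat.lt_succ_of_le hn)
    rw [div_lt_iff₀ (by positivity)] at h1
    rw [div_mul_eq_mul_div, div_lt_iff₀ (by positivity)]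
    linarith
  rw [Real.dist_eq, sub_zero, abs_of_nonneg (avg_nonneg fun f => by split_ifs <;> norm_num)]
  have hpt : ∀ f : Fin (n + 1) × Fin k → Fin (n + 1),
      (if ε ≤ |(reachCard f / (n + 1 : ℕ) : ℝ) - τ / k| then (1 : ℝ) else 0)
      ≤ (if (reachCard f : ℝ) ≤ (n + 1 : ℕ) / (2 * z) then (1 : ℝ) else 0)
        + 1 / ((n + 1 : ℕ) * c ^ 2) * dev (n + 1) (reachCard f) (k * reachCard f) ^ 2 := by
    intro f
    have hd : 0 ≤ 1 / ((n + 1 : ℕ) * c ^ 2) *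
        dev (n + 1) (reachCard f) (k * reachCard f) ^ 2 := by positivity
    by_cases h1 : ε ≤ |(reachCard f / (n + 1 : ℕ) : ℝ) - τ / k|
    swap
    · rw [if_neg h1]
      refine add_nonneg ?_ hd
      split_ifs <;> norm_num
    rw [if_pos h1]
    by_cases h2 : (reachCard f : ℝ) ≤ (n + 1 : ℕ) / (2 * z)
    · rw [if_pos h2]
      linarith
    rw [if_neg h2, zero_add]
    have h3 := hcle _ ⟨?_, (reachCard_div_mem f).2⟩ h1
    · rw [dev_eq_drift, mul_pow, Real.sq_sqrt hn0.le, ← sq_abs (drift _ _ - 1)]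
      have h4 : c ^ 2 ≤ |drift k (reachCard f / (n + 1 : ℕ)) - 1| ^ 2 := by gcongr
      rw [div_mul_eq_mul_div, le_div_iff₀ (by positivity)]
      nlinarith
    · rw [le_div_iff₀ hn0]
      push Not at h2
      rw [one_div_mul_eq_div]
      exact h2.le
  calc _ ≤ _ := avg_mono hpt
    _ = avg (fun f : Fin (n + 1) × Fin k → Fin (n + 1) =>
          if (reachCard f : ℝ) ≤ (n + 1 : ℕ) / (2 * z) then (1 : ℝ) else 0)
        + 1 / ((n + 1 : ℕ) * c ^ 2) * avg (fun f : Fin (n + 1) × Fin k → Fin (n + 1) =>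
          dev (n + 1) (reachCard f) (k * reachCard f) ^ 2) := by
        rw [avg_add, avg_mul_left]
    _ ≤ 1 / z ^ 2 + 1 / ((n + 1 : ℕ) * c ^ 2) * K := by
        gcongr
        · exact avg_card_reachFrom_small_le hk n.succ_pos 0 hz2
        · exact avg_dev_sq_le n.succ_pos 0
    _ < r := by linarith

lemma tendsto_avg_comp_reachCard_div (hk : 2 ≤ k) (hτ0 : 0 < τ)
    (hτ : 1 - τ / k - Real.exp (-τ) = 0) {ω : ℝ → ℝ} (hω : Continuous ω) (hω0 : ∀ t, 0 ≤ ω t)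
    (hων : ω (τ / k) = 0) :
    Tendsto (fun n : ℕ => avg fun f : Fin (n + 1) × Fin k → Fin (n + 1) =>
      ω (reachCard f / (n + 1 : ℕ))) atTop (𝓝 0) := by
  rw [Metric.tendsto_atTop]
  intro r hr
  obtain ⟨ε, hε, hωε⟩ := Metric.continuous_iff.1 hω (τ / k) (r / 2) (by positivity)
  obtain ⟨B, hB⟩ := (isCompact_Icc (a := (0 : ℝ)) (b := 1)).exists_bound_of_continuousOn
    hω.continuousOn
  have hB0 : 0 ≤ B := (norm_nonneg _).trans (hB 0 (by simp))
  obtain ⟨N, hN⟩ := Metric.tendsto_atTop.1 (tendsto_avg_abs_reachCard_div_sub hk hτ0 hτ hε)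
    (r / (2 * (B + 1))) (by positivity)
  refine ⟨N, fun n hn => ?_⟩
  have h1 := hN n hn
  rw [Real.dist_eq, sub_zero, abs_of_nonneg (avg_nonneg fun f => by split_ifs <;> norm_num)] at h1
  rw [Real.dist_eq, sub_zero, abs_of_nonneg (avg_nonneg fun f => hω0 _)]
  have hpt : ∀ f : Fin (n + 1) × Fin k → Fin (n + 1), ω (reachCard f / (n + 1 : ℕ))
      ≤ r / 2 + B * (if ε ≤ |(reachCard f / (n + 1 : ℕ) : ℝ) - τ / k| then (1 : ℝ) else 0) := by
    intro f
    split_ifs with h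
    · have := hB _ (Set.Ioc_subset_Icc_self (reachCard_div_mem f))
      have := (le_abs_self _).trans this
      linarith
    · have := hωε _ (not_le.1 h)
      rw [hων, Real.dist_eq, sub_zero] at this
      have := (le_abs_self _).trans this.le
      linarith
  calc _ ≤ _ := avg_mono hpt
    _ = r / 2 + B * avg fun f : Fin (n + 1) × Fin k → Fin (n + 1) =>
        if ε ≤ |(reachCard f / (n + 1 : ℕ) : ℝ) - τ / k| then (1 : ℝ) else 0 := by
        rw [avg_add, avg_mul_left, avg_const]
    _ ≤ r / 2 + B * (r / (2 * (B + 1))) := by gcongr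
    _ < r / 2 + (B + 1) * (r / (2 * (B + 1))) := by gcongr; linarith
    _ = r := by field_simp; ring

/-- The characteristic function of `dev` at the end of the exploration converges. -/
theorem tendsto_avg_exp_dev (hk : 2 ≤ k) (hτ0 : 0 < τ)
    (hτ : 1 - τ / k - Real.exp (-τ) = 0) (θ : ℝ) :
    Tendsto (fun n : ℕ => avg fun f : Fin (n + 1) × Fin k → Fin (n + 1) =>
      Complex.exp (θ * dev (n + 1) (reachCard f) (k * reachCard f) * Complex.I)) atTop
      (𝓝 (Complex.exp (-(θ ^ 2 * devVar τ / 2)))) := by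
  have hk0 : (k : ℝ) ≠ 0 := by positivity
  set c : ℝ := Real.exp (θ ^ 2 * devVar τ / 2) with hc
  obtain ⟨K, hK⟩ := exists_norm_avg_expDev_sub_one_le k θ
  have hω := tendsto_avg_comp_reachCard_div hk hτ0 hτ
    (ω := fun α => |c - Real.exp (θ ^ 2 * devVar (k * α) / 2)|)
    (by unfold devVar; fun_prop) (fun _ => abs_nonneg _)
    (by rw [mul_div_cancel₀ _ hk0, hc, sub_self, abs_zero])
  have hKlim : Tendsto (fun n : ℕ => K / √((n + 1 : ℕ) : ℝ)) atTop (𝓝 0) := by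
    apply Tendsto.const_div_atTop
    exact Real.tendsto_sqrt_atTop.comp
      (tendsto_natCast_atTop_atTop.comp (tendsto_add_atTop_nat 1))
  have hlim : Tendsto (fun n : ℕ => (c : ℂ) * avg fun f : Fin (n + 1) × Fin k → Fin (n + 1) =>
      Complex.exp (θ * dev (n + 1) (reachCard f) (k * reachCard f) * Complex.I)) atTop
      (𝓝 1) := by
    rw [tendsto_iff_norm_sub_tendsto_zero]
    have hsum := hω.add hKlim
    rw [add_zero] at hsum
    refine squeeze_zero (fun _ => norm_nonneg _) (fun n => ?_) hsum
    have hpt : ∀ f : Fin (n + 1) × Fin k → Fin (n + 1),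
        ‖(c : ℂ) * Complex.exp (θ * dev (n + 1) (reachCard f) (k * reachCard f) * Complex.I)
          - expDev (n + 1) θ (reachCard f) (k * reachCard f)‖
        = |c - Real.exp (θ ^ 2 * devVar (k * (reachCard f / (n + 1 : ℕ))) / 2)| := by
      intro f
      have e1 : expDev (n + 1) θ (reachCard f) (k * reachCard f)
          = Complex.exp (θ * dev (n + 1) (reachCard f) (k * reachCard f) * Complex.I)
            * (Real.exp (θ ^ 2 * devVar (k * (reachCard f / (n + 1 : ℕ))) / 2) : ℝ) := by
        rw [expDev, Complex.exp_add, Complex.ofReal_exp]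
        congr 2
        rw [← mul_div_assoc]
        push_cast
        ring
      have e2 : (θ * dev (n + 1) (reachCard f) (k * reachCard f) * Complex.I : ℂ)
          = ((θ * dev (n + 1) (reachCard f) (k * reachCard f) : ℝ) : ℂ) * Complex.I := by
        push_cast
        ring
      rw [e1, mul_comm (c : ℂ), ← mul_sub, norm_mul, e2, Complex.norm_exp_ofReal_mul_I, one_mul,
        ← Complex.ofReal_sub, Complex.norm_real, Real.norm_eq_abs]
    refine (norm_sub_le_norm_sub_add_norm_sub _
      (avg fun f : Fin (n + 1) × Fin k → Fin (n + 1) =>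
        expDev (n + 1) θ (reachCard f) (k * reachCard f)) _).trans
      (add_le_add ?_ (hK (n + 1) n.succ_pos 0))
    rw [← avg_complex_mul_left, ← avg_sub]
    refine (norm_avg_le _).trans (le_of_eq ?_)
    simp only [hpt]
  have hc0 : (c : ℂ) ≠ 0 := by
    rw [hc]
    exact_mod_cast (Real.exp_pos _).ne'
  have hcinv : Complex.exp (-(θ ^ 2 * devVar τ / 2)) = (c : ℂ)⁻¹ * 1 := by
    rw [Complex.exp_neg, mul_one, hc]
    push_cast
    rfl
  rw [hcinv]
  refine (hlim.const_mul (c : ℂ)⁻¹).congr fun n => ?_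
  rw [inv_mul_cancel_left₀ hc0]

end Concentration

section CentralLimit

open scoped Topology

variable {k : ℕ} {τ : ℝ}

lemma tendsto_sqrt_succ_atTop : Tendsto (fun n : ℕ => √((n + 1 : ℕ) : ℝ)) atTop atTop :=
  Real.tendsto_sqrt_atTop.comp (tendsto_natCast_atTop_atTop.comp (tendsto_add_atTop_nat 1))

lemma exp_sub_pos_of_root (hk : 2 ≤ k) (hτ0 : 0 < τ) (hτ : 1 - τ / k - Real.exp (-τ) = 0) :
    0 < Real.exp τ - k := by
  have hk0 : (0 : ℝ) < k := by positivity
  have h1 := sub_one_lt_of_root hk0 hτ0 hτ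
  have h2 : Real.exp τ * (k - τ) = k := by
    have e1 : (k : ℝ) * (τ / k) = τ := mul_div_cancel₀ _ hk0.ne'
    have e2 : Real.exp (-τ) * Real.exp τ = 1 := by rw [← Real.exp_add]; simp
    linear_combination Real.exp τ * k * hτ + Real.exp τ * e1 + k * e2
  nlinarith [Real.exp_pos τ]

lemma exp_sub_mul_sqrt_eq (hk : 2 ≤ k) (hτ0 : 0 < τ) (hτ : 1 - τ / k - Real.exp (-τ) = 0) :
    (Real.exp τ - k) * √(τ / (k * Real.exp τ * (1 - k * Real.exp (-τ)))) = √(devVar τ) := by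
  have hk0 : (0 : ℝ) < k := by positivity
  have h1 := exp_sub_pos_of_root hk hτ0 hτ
  have e1 : (k : ℝ) * (τ / k) = τ := mul_div_cancel₀ _ hk0.ne'
  have e2 : Real.exp (-τ) * Real.exp τ = 1 := by rw [← Real.exp_add]; simp
  have e3 : k * Real.exp τ * (1 - k * Real.exp (-τ)) = k * (Real.exp τ - k) := by
    linear_combination -k * k * e2
  have e4 : devVar τ = (Real.exp τ - k) ^ 2 * (τ / (k * (Real.exp τ - k))) := by
    have : (Real.exp τ - k) ^ 2 * (τ / (k * (Real.exp τ - k))) = (Real.exp τ - k) * (τ / k) := by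
      field_simp
    rw [this, devVar]
    linear_combination Real.exp τ * hτ + e1 + e2
  rw [e3, e4, Real.sqrt_mul (by positivity), Real.sqrt_sq h1.le]

/-- The linearization of `drift` at its nontrivial root. -/
lemma tendsto_sqrt_mul_drift_sub_one (hk : 2 ≤ k)
    (hτ : 1 - τ / k - Real.exp (-τ) = 0) {m : ℕ → ℝ} {s : ℝ}
    (hm : Tendsto (fun n : ℕ => √(n + 1 : ℕ) * (m n / (n + 1 : ℕ) - τ / k)) atTop (𝓝 s)) :
    Tendsto (fun n : ℕ => m n / (n + 1 : ℕ)) atTop (𝓝 (τ / k)) ∧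
    Tendsto (fun n : ℕ => √(n + 1 : ℕ) * (drift k (m n / (n + 1 : ℕ)) - 1)) atTop
      (𝓝 ((k - Real.exp τ) * s)) := by
  have hk0 : (0 : ℝ) < k := by positivity
  have h1 : Tendsto (fun n : ℕ => m n / (n + 1 : ℕ)) atTop (𝓝 (τ / k)) := by
    have := (hm.div_atTop tendsto_sqrt_succ_atTop).add_const (τ / k)
    rw [zero_add] at this
    refine this.congr fun n => ?_
    have : √((n + 1 : ℕ) : ℝ) ≠ 0 := (Real.sqrt_pos.2 (by positivity)).ne'
    rw [mul_div_cancel_left₀ _ this, sub_add_cancel]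
  refine ⟨h1, ?_⟩
  have hd := hasDerivAt_drift k (τ / k)
  have hd' : deriv (drift k) (τ / k) = k - Real.exp τ := by
    have e1 : (k : ℝ) * (τ / k) = τ := mul_div_cancel₀ _ hk0.ne'
    have e2 : Real.exp (-τ) * Real.exp τ = 1 := by rw [← Real.exp_add]; simp
    rw [hd.deriv, e1]
    linear_combination Real.exp τ * k * hτ + k * e2
  have h2 : Tendsto (fun n : ℕ => dslope (drift k) (τ / k) (m n / (n + 1 : ℕ))) atTop
      (𝓝 (k - Real.exp τ)) := by
    have := (continuousAt_dslope_same.2 hd.differentiableAt).tendsto.comp h1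
    rwa [dslope_same, hd'] at this
  refine (h2.mul hm).congr fun n => ?_
  have := sub_smul_dslope (drift k) (τ / k) (m n / (n + 1 : ℕ))
  rw [smul_eq_mul, drift_root hk0 hτ] at this
  rw [← this]
  ring

/-- The central limit theorem for the number of vertices reachable from a given vertex. -/
theorem tendsto_avg_reachCard_le (hk : 2 ≤ k) (hτ0 : 0 < τ)
    (hτ : 1 - τ / k - Real.exp (-τ) = 0) {m : ℕ → ℝ} {x : ℝ}
    (hm : Tendsto (fun n : ℕ => √(n + 1 : ℕ) * (m n / (n + 1 : ℕ) - τ / k)) atTop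
      (𝓝 (√(τ / (k * Real.exp τ * (1 - k * Real.exp (-τ)))) * x))) :
    Tendsto (fun n : ℕ => avg fun f : Fin (n + 1) × Fin k → Fin (n + 1) =>
      if (reachCard f : ℝ) ≤ m n then (1 : ℝ) else 0) atTop (𝓝 (normalCDF x)) := by
  have hk0 : (0 : ℝ) < k := by positivity
  obtain ⟨h1, h2⟩ := tendsto_sqrt_mul_drift_sub_one hk hτ hm
  have hV : 0 < √(devVar τ) := Real.sqrt_pos.2 (devVar_pos hτ0.ne')
  have hVV : √(devVar τ) ^ 2 = devVar τ := Real.sq_sqrt (devVar_pos hτ0.ne').le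
  have hν := one_sub_lt_root_div hk0 hτ0 hτ
  have hy : Tendsto (fun n : ℕ => -(√(n + 1 : ℕ) * (drift k (m n / (n + 1 : ℕ)) - 1))
      / √(devVar τ)) atTop (𝓝 x) := by
    have := h2.neg.div_const √(devVar τ)
    convert this using 2
    rw [eq_div_iff hV.ne', ← exp_sub_mul_sqrt_eq hk hτ0 hτ]
    ring
  have hG := tendsto_avg_ite_le (α := fun n => Fin (n + 1) × Fin k → Fin (n + 1))
    (fun n f => -dev (n + 1) (reachCard f) (k * reachCard f) / √(devVar τ)) (fun θ => by
      convert tendsto_avg_exp_dev hk hτ0 hτ (-θ / √(devVar τ)) using 6 with n f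
      · push_cast
        ring
      · rw [← Complex.ofReal_pow, ← Complex.ofReal_pow, ← Complex.ofReal_mul, div_pow, hVV,
          neg_sq, div_mul_cancel₀ _ (devVar_pos hτ0.ne').ne']) hy
  have hH := tendsto_avg_abs_reachCard_div_sub hk hτ0 hτ (sub_pos.2 hν)
  have hpt : ∀ᶠ n : ℕ in atTop, ∀ f : Fin (n + 1) × Fin k → Fin (n + 1),
      τ / k - (1 - 1 / k) ≤ |(reachCard f / (n + 1 : ℕ) : ℝ) - τ / k| ∨
      ((reachCard f : ℝ) ≤ m n ↔ -dev (n + 1) (reachCard f) (k * reachCard f) / √(devVar τ)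
        ≤ -(√(n + 1 : ℕ) * (drift k (m n / (n + 1 : ℕ)) - 1)) / √(devVar τ)) := by
    filter_upwards [h1.eventually_const_lt hν] with n hn f
    rw [or_iff_not_imp_left, not_le]
    intro hf
    have hn0 : (0 : ℝ) < (n + 1 : ℕ) := by positivity
    have hs : 0 < √((n + 1 : ℕ) : ℝ) := Real.sqrt_pos.2 hn0
    have hY : (1 - 1 / k : ℝ) ≤ reachCard f / (n + 1 : ℕ) := by
      linarith [neg_abs_le ((reachCard f / (n + 1 : ℕ) : ℝ) - τ / k)]
    rw [dev_eq_drift, div_le_div_iff_of_pos_right hV, neg_le_neg_iff, mul_le_mul_iff_right₀ hs,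
      sub_le_sub_iff_right, (strictAntiOn_drift hk0).le_iff_ge hn.le hY,
      div_le_div_iff_of_pos_right hn0]
  have hlo := hG.sub hH
  have hhi := hG.add hH
  rw [sub_zero] at hlo
  rw [add_zero] at hhi
  refine tendsto_of_tendsto_of_tendsto_of_le_of_le' hlo hhi ?_ ?_
  · filter_upwards [hpt] with n hn
    rw [← avg_sub]
    refine avg_mono fun f => ?_
    rcases hn f with h | h
    · simp only [if_pos h]
      split_ifs <;> norm_num
    · simp only [h]
      split_ifs <;> norm_num
  · filter_upwards [hpt] with n hn
    rw [← avg_add]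
    refine avg_mono fun f => ?_
    rcases hn f with h | h
    · simp only [if_pos h]
      split_ifs <;> norm_num
    · simp only [h]
      split_ifs <;> norm_num

lemma exists_subcritical_exponent {ρ : ℝ} (h0 : 0 < ρ) (h1 : ρ < 1) :
    ∃ lam : ℝ, 0 ≤ lam ∧ ρ * (Real.exp lam - 1) < lam := by
  refine ⟨(1 - ρ) / 2, by linarith, ?_⟩
  have := (exp_sub_one_sub_mem (ε := (1 - ρ) / 2) (by linarith) (by linarith)).2
  nlinarith

/-- No vertex reaches much more than what is already reachable from `0`. -/
theorem exists_tendsto_sum_avg_pair (hk : 2 ≤ k) (hτ0 : 0 < τ)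
    (hτ : 1 - τ / k - Real.exp (-τ) = 0) :
    ∃ γ < τ / k, Tendsto (fun n : ℕ => ∑ v : Fin (n + 1),
      avg fun f : Fin (n + 1) × Fin k → Fin (n + 1) =>
        if γ * (n + 1 : ℕ) ≤ reachCard f ∧
          (reachCard f : ℝ) + √√(n + 1 : ℕ) ≤ (reachFrom f ({0} ∪ {v})).card
        then (1 : ℝ) else 0) atTop (𝓝 0) := by
  have hk0 : (0 : ℝ) < k := by positivity
  have hν := one_sub_lt_root_div hk0 hτ0 hτ
  have hν1 := root_lt hτ
  obtain ⟨γ, hγ0, hγ1⟩ := exists_between hν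
  refine ⟨γ, hγ1, ?_⟩
  have hρ : k * (1 - γ) < 1 := by
    have : 1 - γ < 1 / k := by linarith
    rw [lt_div_iff₀ hk0] at this
    linarith
  obtain ⟨lam, hlam0, hlam⟩ := exists_subcritical_exponent
    (mul_pos hk0 (by linarith : 0 < 1 - γ)) hρ
  rw [mul_assoc] at hlam
  set η := lam - k * ((1 - γ) * (Real.exp lam - 1)) with hη
  have hη0 : 0 < η := by linarith
  have hlim : Tendsto (fun n : ℕ =>
      Real.exp lam * (√√((n + 1 : ℕ) : ℝ) ^ (4 : ℝ) * Real.exp (-η * √√((n + 1 : ℕ) : ℝ))))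
      atTop (𝓝 0) := by
    have := ((tendsto_rpow_mul_exp_neg_mul_atTop_nhds_zero 4 η hη0).comp
      (Real.tendsto_sqrt_atTop.comp tendsto_sqrt_succ_atTop)).const_mul (Real.exp lam)
    simpa [Function.comp_def] using this
  refine squeeze_zero (fun n => Finset.sum_nonneg fun v _ => avg_nonneg fun f => ?_)
    (fun n => ?_) hlim
  · split_ifs <;> norm_num
  · have hn0 : (0 : ℝ) < (n + 1 : ℕ) := by positivity
    have hL : 0 < √√((n + 1 : ℕ) : ℝ) := Real.sqrt_pos.2 (Real.sqrt_pos.2 hn0)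
    have h4 : √√((n + 1 : ℕ) : ℝ) ^ (4 : ℝ) = (n + 1 : ℕ) := by
      have : (4 : ℝ) = ((2 * 2 : ℕ) : ℝ) := by norm_num
      rw [this, Real.rpow_natCast, pow_mul, Real.sq_sqrt (Real.sqrt_nonneg _),
        Real.sq_sqrt hn0.le]
    calc _ ≤ ∑ _v : Fin (n + 1), Real.exp (lam - η * √√((n + 1 : ℕ) : ℝ)) :=
          Finset.sum_le_sum fun v _ =>
            avg_card_reachFrom_pair_le n.succ_pos 0 v hlam0 hlam.le hL
      _ = _ := by
          rw [Finset.sum_const, Finset.card_univ, Fintype.card_fin, nsmul_eq_mul, h4,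
            sub_eq_add_neg, Real.exp_add, neg_mul]
          ring

/-- The maximal spectrum size. -/
noncomputable def maxSpec {n k : ℕ} (f : Fin n × Fin k → Fin n) : ℕ :=
  Finset.univ.sup fun v : Fin n => (specSet f v).ncard

lemma reachCard_le_maxSpec {n : ℕ} (f : Fin (n + 1) × Fin k → Fin (n + 1)) :
    reachCard f ≤ maxSpec f := by
  have := Finset.le_sup (f := fun v : Fin (n + 1) => (specSet f v).ncard) (Finset.mem_univ 0)
  simpa [reachCard, maxSpec, specSet_eq, Set.ncard_coe_finset] using this

lemma exists_maxSpec_le {n : ℕ} (f : Fin (n + 1) × Fin k → Fin (n + 1)) :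
    ∃ v, maxSpec f ≤ (reachFrom f ({0} ∪ {v})).card := by
  obtain ⟨v, -, hv⟩ := Finset.exists_mem_eq_sup Finset.univ Finset.univ_nonempty
    fun v : Fin (n + 1) => (specSet f v).ncard
  refine ⟨v, ?_⟩
  rw [maxSpec, hv]
  simp only [specSet_eq, Set.ncard_coe_finset]
  exact Finset.card_le_card (reachFrom_mono f Finset.subset_union_right)

theorem tendsto_avg_maxSpec_le (hk : 2 ≤ k) (hτ0 : 0 < τ)
    (hτ : 1 - τ / k - Real.exp (-τ) = 0) (x : ℝ) :
    Tendsto (fun n : ℕ => avg fun f : Fin (n + 1) × Fin k → Fin (n + 1) =>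
      if (maxSpec f : ℝ) ≤ τ / k * (n + 1 : ℕ)
        + √(τ / (k * Real.exp τ * (1 - k * Real.exp (-τ)))) * √(n + 1 : ℕ) * x
      then (1 : ℝ) else 0) atTop (𝓝 (normalCDF x)) := by
  set σ := √(τ / (k * Real.exp τ * (1 - k * Real.exp (-τ)))) with hσ
  obtain ⟨γ, hγ, hpair⟩ := exists_tendsto_sum_avg_pair hk hτ0 hτ
  have hconc := tendsto_avg_abs_reachCard_div_sub hk hτ0 hτ (sub_pos.2 hγ)
  have hcenter : ∀ n : ℕ, √(n + 1 : ℕ) * ((τ / k * (n + 1 : ℕ) + σ * √(n + 1 : ℕ) * x)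
      / (n + 1 : ℕ) - τ / k) = σ * x := by
    intro n
    have hn0 : (0 : ℝ) < (n + 1 : ℕ) := by positivity
    have hs : √((n + 1 : ℕ) : ℝ) * √(n + 1 : ℕ) = (n + 1 : ℕ) := Real.mul_self_sqrt hn0.le
    rw [add_div, mul_div_cancel_right₀ _ hn0.ne', add_sub_cancel_left, ← mul_div_assoc,
      div_eq_iff hn0.ne']
    linear_combination σ * x * hs
  have hup := tendsto_avg_reachCard_le hk hτ0 hτ (x := x)
    (m := fun n => τ / k * (n + 1 : ℕ) + σ * √(n + 1 : ℕ) * x)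
    (by simp only [hcenter]; exact tendsto_const_nhds)
  have hlow := tendsto_avg_reachCard_le hk hτ0 hτ (x := x)
    (m := fun n => τ / k * (n + 1 : ℕ) + σ * √(n + 1 : ℕ) * x - √√(n + 1 : ℕ)) (by
      have h0 : Tendsto (fun n : ℕ => σ * x - 1 / √√((n + 1 : ℕ) : ℝ)) atTop
          (𝓝 (σ * x - 0)) := by
        refine tendsto_const_nhds.sub (Tendsto.const_div_atTop ?_ _)
        exact Real.tendsto_sqrt_atTop.comp tendsto_sqrt_succ_atTop
      rw [sub_zero] at h0
      refine h0.congr fun n => ?_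
      have hn0 : (0 : ℝ) < (n + 1 : ℕ) := by positivity
      have hs0 : 0 < √((n + 1 : ℕ) : ℝ) := Real.sqrt_pos.2 hn0
      have ht0 : 0 < √√((n + 1 : ℕ) : ℝ) := Real.sqrt_pos.2 hs0
      have hs : √((n + 1 : ℕ) : ℝ) * √(n + 1 : ℕ) = (n + 1 : ℕ) := Real.mul_self_sqrt hn0.le
      have ht : √√((n + 1 : ℕ) : ℝ) * √√(n + 1 : ℕ) = √(n + 1 : ℕ) := Real.mul_self_sqrt hs0.le
      have e : √((n + 1 : ℕ) : ℝ) * (√√(n + 1 : ℕ) / (n + 1 : ℕ)) = 1 / √√(n + 1 : ℕ) := by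
        rw [← mul_div_assoc, div_eq_div_iff hn0.ne' ht0.ne', mul_assoc, ht, hs, one_mul]
      rw [← hcenter n, ← e, sub_div]
      ring)
  have hlo := (hlow.sub hconc).sub hpair
  rw [sub_zero, sub_zero] at hlo
  refine tendsto_of_tendsto_of_tendsto_of_le_of_le hlo hup (fun n => ?_) (fun n => ?_)
  · dsimp only
    rw [← avg_sum, ← avg_sub, ← avg_sub]
    refine avg_mono fun f => ?_
    set m := τ / k * (n + 1 : ℕ) + σ * √(n + 1 : ℕ) * x
    have hn0 : (0 : ℝ) < (n + 1 : ℕ) := by positivity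
    have hnn : ∀ v : Fin (n + 1), (0 : ℝ) ≤ if γ * (n + 1 : ℕ) ≤ reachCard f ∧
        (reachCard f : ℝ) + √√(n + 1 : ℕ) ≤ (reachFrom f ({0} ∪ {v})).card then (1 : ℝ) else 0 :=
      fun v => by split_ifs <;> norm_num
    have hsum := Finset.sum_nonneg fun v (_ : v ∈ Finset.univ) => hnn v
    by_cases h1 : (reachCard f : ℝ) ≤ m - √√(n + 1 : ℕ)
    swap
    · rw [if_neg h1]
      split_ifs <;> linarith
    by_cases h2 : (maxSpec f : ℝ) ≤ m
    · rw [if_pos h1, if_pos h2]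
      split_ifs <;> linarith
    rw [if_pos h1, if_neg h2]
    by_cases h3 : γ * (n + 1 : ℕ) ≤ reachCard f
    · obtain ⟨v, hv⟩ := exists_maxSpec_le f
      have hv' : (maxSpec f : ℝ) ≤ (reachFrom f ({0} ∪ {v})).card := by exact_mod_cast hv
      have h4 := Finset.single_le_sum (fun v _ => hnn v) (Finset.mem_univ v)
      rw [if_pos ⟨h3, by linarith⟩] at h4
      split_ifs <;> linarith
    · have h5 : τ / k - γ ≤ |(reachCard f / (n + 1 : ℕ) : ℝ) - τ / k| := by
        have : (reachCard f / (n + 1 : ℕ) : ℝ) < γ := by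
          rw [div_lt_iff₀ hn0]
          exact not_le.1 h3
        linarith [neg_abs_le ((reachCard f / (n + 1 : ℕ) : ℝ) - τ / k)]
      rw [if_pos h5]
      linarith
  · refine avg_mono fun f => ?_
    have h : (reachCard f : ℝ) ≤ maxSpec f := by exact_mod_cast reachCard_le_maxSpec f
    split_ifs with h1 h2
    · exact le_rfl
    · exact absurd (h.trans h1) h2
    · norm_num
    · exact le_rfl

end CentralLimit

/-- Central limit law for the maximum spectrum size of `𝒟_{n,k}`:
`(max_v |Q(v)| - ν_k n)/(σ_k √n)` converges in distribution to a standard normal. -/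
theorem max_spectrum_clt (k : ℕ) (hk : 2 ≤ k) (τ : ℝ) (hτpos : 0 < τ)
    (hτ : 1 - τ / k - Real.exp (-τ) = 0) (x : ℝ) :
    Filter.Tendsto (fun n : ℕ =>
      prob n k (fun f =>
        (((Finset.univ.sup fun v : Fin n => (specSet f v).ncard : ℕ) : ℝ) - (τ / k) * n) /
          (Real.sqrt (τ / (k * Real.exp τ * (1 - k * Real.exp (-τ)))) * Real.sqrt n) ≤ x))
      Filter.atTop
      (nhds ((Real.sqrt (2 * Real.pi))⁻¹ * ∫ t in Set.Iic x, Real.exp (-t ^ 2 / 2))) := by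
  have hk0 : (0 : ℝ) < k := by positivity
  have hσ : 0 < √(τ / (k * Real.exp τ * (1 - k * Real.exp (-τ)))) := by
    have h1 := exp_sub_mul_sqrt_eq hk hτpos hτ
    have h2 : 0 < √(devVar τ) := Real.sqrt_pos.2 (devVar_pos hτpos.ne')
    rw [← h1] at h2
    exact pos_of_mul_pos_right h2 (exp_sub_pos_of_root hk hτpos hτ).le
  refine (tendsto_add_atTop_iff_nat 1).1
    ((tendsto_avg_maxSpec_le hk hτpos hτ x).congr fun n => ?_)
  have hs : 0 < √((n + 1 : ℕ) : ℝ) := Real.sqrt_pos.2 (by positivity)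
  rw [prob_eq_avg]
  congr 1
  funext f
  congr 1
  apply propext
  rw [div_le_iff₀ (mul_pos hσ hs), sub_le_iff_le_add', mul_comm x, maxSpec]
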